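/- arXiv:1107.2526 — 9 statements merged into one kernel-verified Lean document; each statement's English description precedes it below -/
import Mathlib

section
/- Let x : ℝ → ℝ^d be an absolutely continuous solution of the differential inclusion dx/dt ∈ F(x) (i.e. dx(t)/dt ∈ F(x(t)) for almost every t) such that x(t) ∈ G for all t ∈ ℝ. Then for almost every t ∈ ℝ, dx(t)/dt = P_{T_G(x(t))}(−∇f(x(t))), where P_{T_G(x)} denotes the Euclidean projection onto the tangent cone T_G(x). -/
open MeasureTheory Metric
open scoped RealInnerProductSpace

/-- The normal cone of a set `G ⊆ ℝ^d` at `θ`: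
`N_G(θ) = {v : ∀ θ' ∈ G, ⟪v, θ - θ'⟫ ≥ 0}`. -/
def normalCone {d : ℕ} (G : Set (EuclideanSpace ℝ (Fin d))) (θ : EuclideanSpace ℝ (Fin d)) :
    Set (EuclideanSpace ℝ (Fin d)) :=
  {v | ∀ θ' ∈ G, 0 ≤ ⟪v, θ - θ'⟫}

/-- The tangent cone of `G` at `θ`: the closure of `{c • (θ' - θ) : θ' ∈ G, c ≥ 0}`. -/
def tangentConeOf {d : ℕ} (G : Set (EuclideanSpace ℝ (Fin d))) (θ : EuclideanSpace ℝ (Fin d)) :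
    Set (EuclideanSpace ℝ (Fin d)) :=
  closure {w | ∃ θ' ∈ G, ∃ c : ℝ, 0 ≤ c ∧ w = c • (θ' - θ)}

/-- The set-valued map `F(θ) = {-∇f(θ) - z : z ∈ N_G(θ), |z| ≤ c}`. -/
def Fmap {d : ℕ} (G : Set (EuclideanSpace ℝ (Fin d))) (f : EuclideanSpace ℝ (Fin d) → ℝ)
    (c : ℝ) (θ : EuclideanSpace ℝ (Fin d)) : Set (EuclideanSpace ℝ (Fin d)) :=
  {w | ∃ z ∈ normalCone G θ, ‖z‖ ≤ c ∧ w = -gradient f θ - z}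

/-- If `x : ℝ → ℝ^d` is absolutely continuous (encoded via a locally
integrable a.e. derivative `x'` satisfying the fundamental theorem of calculus), takes values
in the nonempty compact convex set `G`, and satisfies `x'(t) ∈ F(x(t))` for a.e. `t`, then
for a.e. `t`, `x'(t)` is the Euclidean projection of `-∇f(x(t))` onto the tangent cone
`T_G(x(t))`. -/
theorem stmt_5 {d : ℕ} (G : Set (EuclideanSpace ℝ (Fin d)))
    (hGne : G.Nonempty) (hGcpt : IsCompact G) (hGconv : Convex ℝ G)
    (f : EuclideanSpace ℝ (Fin d) → ℝ) (hf : ContDiff ℝ 1 f)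
    (c : ℝ) (hc : 0 < c)
    (x x' : ℝ → EuclideanSpace ℝ (Fin d))
    (hxG : ∀ t, x t ∈ G)
    (hint : ∀ a b : ℝ, IntervalIntegrable x' volume a b)
    (hftc : ∀ a b : ℝ, x b - x a = ∫ t in a..b, x' t)
    (hincl : ∀ᵐ t : ℝ, x' t ∈ Fmap G f c (x t)) :
    ∀ᵐ t : ℝ, x' t ∈ tangentConeOf G (x t) ∧
      ∀ w ∈ tangentConeOf G (x t),
        ‖-gradient f (x t) - x' t‖ ≤ ‖-gradient f (x t) - w‖ := by
  have hloc : LocallyIntegrable x' volume := by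
    intro t
    refine ⟨Set.Ioc (t - 1) (t + 1), Ioc_mem_nhds (by linarith) (by linarith), ?_⟩
    exact (hint (t - 1) (t + 1)).1
  filter_upwards [hincl, LocallyIntegrable.ae_hasDerivAt_integral hloc] with t ht hd
  have hder : HasDerivAt x (x' t) t := by
    have hx : x = fun s => x 0 + ∫ u in (0:ℝ)..s, x' u := by
      funext s
      rw [← hftc 0 s]
      abel
    rw [hx]
    exact (hd 0).const_add (x 0)
  obtain ⟨z, hz, -, hxz⟩ := ht
  have horth : ⟪z, x' t⟫ = 0 := by
    have h1 : HasDerivAt (fun s => ⟪z, x s⟫) ⟪z, x' t⟫ t := by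
      simpa using (hasDerivAt_const t z).inner ℝ hder
    refine IsLocalMax.hasDerivAt_eq_zero (Filter.Eventually.of_forall fun s => ?_) h1
    have h2 := hz (x s) (hxG s)
    rw [inner_sub_right] at h2
    exact sub_nonneg.mp h2
  refine ⟨?_, ?_⟩
  · refine mem_closure_of_tendsto hder.tendsto_slope_zero_right ?_
    filter_upwards [self_mem_nhdsWithin] with s hs
    exact ⟨x (t + s), hxG _, s⁻¹, inv_nonneg.mpr (le_of_lt hs), rfl⟩
  · intro w hw
    have hzw : ⟪z, w⟫ ≤ 0 := by
      have hcl : IsClosed {w : EuclideanSpace ℝ (Fin d) | ⟪z, w⟫ ≤ 0} :=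
        isClosed_le (by fun_prop) continuous_const
      refine closure_minimal ?_ hcl hw
      rintro _ ⟨θ', hθ', r, hr, rfl⟩
      have h2 := hz θ' hθ'
      rw [inner_sub_right] at h2
      change ⟪z, r • (θ' - x t)⟫ ≤ 0
      rw [inner_smul_right, inner_sub_right]
      exact mul_nonpos_of_nonneg_of_nonpos hr (by linarith)
    have hg : -gradient f (x t) = x' t + z := by rw [hxz]; abel
    rw [hg, add_sub_cancel_left]
    have h3 : ‖z‖ * ‖z‖ ≤ ‖z‖ * ‖x' t + z - w‖ := by
      refine le_trans ?_ (real_inner_le_norm z (x' t + z - w))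
      rw [inner_sub_right, inner_add_right, horth, real_inner_self_eq_norm_mul_norm]
      linarith
    rcases (norm_nonneg z).eq_or_lt with h0 | h0
    · rw [← h0]; exact norm_nonneg _
    · exact le_of_mul_le_mul_left h3 h0
end

section
/- Let x : ℝ → G be an absolutely continuous function satisfying dx(t)/dt = P_{T_G(x(t))}(−∇f(x(t))) for almost every t. Then for almost every t, (d/dt)f(x(t)) = −|P_{T_G(x(t))}(−∇f(x(t)))|². Consequently f is a Lyapunov function for the KKT set ℒ: for every t > 0, f(x(t)) ≤ f(x(0)), with strict inequality whenever x(0) ∉ ℒ. -/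
open MeasureTheory Metric
open scoped RealInnerProductSpace

/-- The set of KKT points `ℒ = {θ ∈ G : -∇f(θ) ∈ N_G(θ)}`. -/
def KKTset {d : ℕ} (G : Set (EuclideanSpace ℝ (Fin d))) (f : EuclideanSpace ℝ (Fin d) → ℝ) :
    Set (EuclideanSpace ℝ (Fin d)) :=
  {θ ∈ G | -gradient f θ ∈ normalCone G θ}

theorem aux_smul_mem {d : ℕ} (G : Set (EuclideanSpace ℝ (Fin d)))
    (θ p : EuclideanSpace ℝ (Fin d)) (hp : p ∈ tangentConeOf G θ) (c : ℝ) (hc : 0 ≤ c) :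
    c • p ∈ tangentConeOf G θ := by
  unfold tangentConeOf at *
  refine map_mem_closure (f := fun w => c • w) (continuous_const_smul c) hp ?_
  rintro w ⟨θ', hθ', e, he, rfl⟩
  exact ⟨θ', hθ', c * e, mul_nonneg hc he, by simp [mul_smul]⟩

theorem aux_inner {d : ℕ} (G : Set (EuclideanSpace ℝ (Fin d)))
    (θ v p : EuclideanSpace ℝ (Fin d)) (hp : p ∈ tangentConeOf G θ)
    (hmin : ∀ w ∈ tangentConeOf G θ, ‖v - p‖ ≤ ‖v - w‖) : ⟪v, p⟫ = ‖p‖ ^ 2 := by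
  have key : ∀ c : ℝ, 0 ≤ c → - 2 * ⟪v, p⟫ + ‖p‖ ^ 2 ≤ -2 * (c * ⟪v, p⟫) + c ^ 2 * ‖p‖ ^ 2 := by
    intro c hc
    have h := hmin _ (aux_smul_mem G θ p hp c hc)
    have h2 := pow_le_pow_left₀ (norm_nonneg _) h 2
    rw [norm_sub_sq_real, norm_sub_sq_real, inner_smul_right, norm_smul, mul_pow,
      Real.norm_eq_abs, sq_abs] at h2
    linarith
  rcases eq_or_ne p 0 with rfl | hp0
  · simp
  · have hb : 0 < ‖p‖ ^ 2 := by positivity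
    generalize ⟪v, p⟫ = a at *
    generalize ‖p‖ ^ 2 = b at *
    have h0 := key 0 le_rfl
    have ha : 0 ≤ a := by linarith
    have h1 := key (a / b) (by positivity)
    have h3 : -2 * (a / b * a) + (a / b) ^ 2 * b = - (a ^ 2 / b) := by
      field_simp
      ring
    rw [h3] at h1
    have h4 : a ^ 2 / b ≤ 2 * a - b := by linarith
    rw [div_le_iff₀ hb] at h4
    nlinarith [sq_nonneg (a - b)]

theorem aux_normal {d : ℕ} (G : Set (EuclideanSpace ℝ (Fin d)))
    (θ v : EuclideanSpace ℝ (Fin d))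
    (hmin : ∀ w ∈ tangentConeOf G θ, ‖v‖ ≤ ‖v - w‖) : v ∈ normalCone G θ := by
  intro θ' hθ'
  have key : ∀ c : ℝ, 0 ≤ c → 0 ≤ -2 * (c * ⟪v, θ' - θ⟫) + c ^ 2 * ‖θ' - θ‖ ^ 2 := by
    intro c hc
    have h := hmin (c • (θ' - θ)) (subset_closure ⟨θ', hθ', c, hc, rfl⟩)
    have h2 := pow_le_pow_left₀ (norm_nonneg _) h 2
    rw [norm_sub_sq_real, inner_smul_right, norm_smul, mul_pow,
      Real.norm_eq_abs, sq_abs] at h2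
    linarith
  rw [← neg_sub θ' θ, inner_neg_right]
  generalize ⟪v, θ' - θ⟫ = a at *
  have hb : 0 ≤ ‖θ' - θ‖ ^ 2 := by positivity
  generalize ‖θ' - θ‖ ^ 2 = b at *
  by_contra! hneg
  have ha : 0 < a := by linarith
  have h1 := key (a / (b + 1)) (by positivity)
  have h3 : -2 * (a / (b + 1) * a) + (a / (b + 1)) ^ 2 * b
      = - (a ^ 2 * (b + 2) / (b + 1) ^ 2) := by
    field_simp
    ring
  rw [h3] at h1
  have : 0 < a ^ 2 * (b + 2) / (b + 1) ^ 2 := by positivity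
  linarith

/-- Let `projT θ v` denote the Euclidean projection of `v` onto the tangent
cone `T_G(θ)`.  If `x : ℝ → G` is absolutely continuous with a.e. derivative
`x'(t) = projT (x t) (-∇f(x t))`, then a.e. `(f ∘ x)'(t) = -|projT (x t) (-∇f(x t))|²`;
consequently `f` is a Lyapunov function for the KKT set `ℒ`: for every `t > 0`,
`f(x t) ≤ f(x 0)`, with strict inequality whenever `x 0 ∉ ℒ`. -/
theorem stmt_6 {d : ℕ} (G : Set (EuclideanSpace ℝ (Fin d)))
    (hGne : G.Nonempty) (hGcpt : IsCompact G) (hGconv : Convex ℝ G)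
    (f : EuclideanSpace ℝ (Fin d) → ℝ) (hf : ContDiff ℝ 1 f)
    (projT : EuclideanSpace ℝ (Fin d) → EuclideanSpace ℝ (Fin d) → EuclideanSpace ℝ (Fin d))
    (hprojT : ∀ θ ∈ G, ∀ v : EuclideanSpace ℝ (Fin d),
      projT θ v ∈ tangentConeOf G θ ∧
        ∀ w ∈ tangentConeOf G θ, ‖v - projT θ v‖ ≤ ‖v - w‖)
    (x x' : ℝ → EuclideanSpace ℝ (Fin d))
    (hxG : ∀ t, x t ∈ G)
    (hint : ∀ a b : ℝ, IntervalIntegrable x' volume a b)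
    (hftc : ∀ a b : ℝ, x b - x a = ∫ t in a..b, x' t)
    (hderiv : ∀ᵐ t : ℝ, HasDerivAt x (x' t) t)
    (hode : ∀ᵐ t : ℝ, x' t = projT (x t) (-gradient f (x t))) :
    (∀ᵐ t : ℝ, HasDerivAt (fun s => f (x s))
        (-‖projT (x t) (-gradient f (x t))‖ ^ 2) t) ∧
    ∀ t : ℝ, 0 < t → f (x t) ≤ f (x 0) ∧ (x 0 ∉ KKTset G f → f (x t) < f (x 0)) := by
  have hin : ∀ t, ⟪-gradient f (x t), projT (x t) (-gradient f (x t))⟫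
      = ‖projT (x t) (-gradient f (x t))‖ ^ 2 := fun t =>
    aux_inner G (x t) _ _ (hprojT _ (hxG t) _).1 (hprojT _ (hxG t) _).2
  have hD : ∀ᵐ t : ℝ, HasDerivAt (fun s => f (x s))
        (-‖projT (x t) (-gradient f (x t))‖ ^ 2) t := by
    filter_upwards [hderiv, hode] with t h1 h2
    have h3 := ((hf.differentiable (by norm_num)) (x t)).hasFDerivAt.comp_hasDerivAt t h1
    convert! h3 using 1
    rw [← hin t, ← h2, inner_neg_left, neg_neg, inner_gradient_left]
  refine ⟨hD, ?_⟩
  obtain ⟨C, hC⟩ := hGcpt.exists_bound_of_continuousOn (f := fderiv ℝ f)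
    (hf.continuous_fderiv (by norm_num)).continuousOn
  obtain ⟨θ₀, hθ₀⟩ := hGne
  have hC0 : 0 ≤ C := (norm_nonneg _).trans (hC θ₀ hθ₀)
  lift C to NNReal using hC0
  have hfL : LipschitzOnWith C f G :=
    hGconv.lipschitzOnWith_of_nnnorm_fderiv_le
      (fun y _ => (hf.differentiable (by norm_num)) y) (fun y hy => hC y hy)
  have hgrad : ∀ t, ‖projT (x t) (-gradient f (x t))‖ ≤ C := by
    intro t
    have h1 := real_inner_le_norm (-gradient f (x t)) (projT (x t) (-gradient f (x t)))
    rw [hin t, norm_neg] at h1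
    have h2 : ‖gradient f (x t)‖ ≤ C := by
      have := hC _ (hxG t)
      rwa [← toDual_gradient, LinearIsometryEquiv.norm_map] at this
    rcases (norm_nonneg (projT (x t) (-gradient f (x t)))).eq_or_lt with h | h
    · rw [← h]; positivity
    · nlinarith
  have hxL : LipschitzWith C x := by
    refine LipschitzWith.of_dist_le_mul fun a b => ?_
    rw [dist_eq_norm, hftc b a, Real.dist_eq]
    refine intervalIntegral.norm_integral_le_of_norm_le_const_ae ?_
    filter_upwards [hode] with s hs _
    rw [hs]
    exact hgrad s
  have hgL : LipschitzWith (C * C) (fun s => f (x s)) := by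
    have := hfL.comp (hxL.lipschitzOnWith (s := Set.univ)) (fun s _ => hxG s)
    exact lipschitzOnWith_univ.mp this
  intro t ht
  have hac : AbsolutelyContinuousOnInterval (fun s => f (x s)) 0 t :=
    hgL.lipschitzOnWith.absolutelyContinuousOnInterval
  have hFTC := hac.integral_deriv_eq_sub
  have hI := hac.intervalIntegrable_deriv
  have hnn : ∀ᵐ s : ℝ, 0 ≤ (fun s => -deriv (fun s => f (x s)) s) s := by
    filter_upwards [hD] with s hs
    simp only [hs.deriv, neg_neg]
    positivity
  have hneg : ∫ s in (0 : ℝ)..t, -deriv (fun s => f (x s)) s = f (x 0) - f (x t) := by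
    rw [intervalIntegral.integral_neg, hFTC]; ring
  have hle : f (x t) ≤ f (x 0) := by
    have := intervalIntegral.integral_nonneg_of_ae (μ := volume) ht.le hnn
    rw [hneg] at this
    linarith
  refine ⟨hle, fun hK => lt_of_le_of_ne hle fun heq => hK ⟨hxG 0, ?_⟩⟩
  rw [heq, sub_self,
    intervalIntegral.integral_eq_zero_iff_of_le_of_nonneg_ae ht.le (ae_restrict_of_ae hnn) hI.neg]
    at hneg
  have hx0 : ∀ᵐ s ∂(volume.restrict (Set.Ioc 0 t)), x' s = 0 := by
    filter_upwards [hneg, ae_restrict_of_ae hD, ae_restrict_of_ae hode] with s h1 h2 h3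
    rw [h2.deriv] at h1
    rw [h3]
    simpa using h1
  have hconst : ∀ s ∈ Set.Ioc 0 t, x s = x 0 := by
    intro s hs
    rw [← sub_eq_zero, hftc 0 s, intervalIntegral.integral_of_le hs.1.le]
    refine integral_eq_zero_of_ae ?_
    exact ae_restrict_of_ae_restrict_of_subset (Set.Ioc_subset_Ioc_right hs.2) hx0
  have hne : (ae (volume.restrict (Set.Ioc 0 t))).NeBot := by
    rw [ae_neBot, Ne, Measure.restrict_eq_zero]
    simpa using ht
  obtain ⟨s, h1, h2, h3⟩ :=
    (hx0.and ((ae_restrict_of_ae hode).and (ae_restrict_mem measurableSet_Ioc))).exists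
  rw [h1, hconst s h3] at h2
  have hm := (hprojT _ (hxG 0) (-gradient f (x 0))).2
  rw [← h2, sub_zero] at hm
  exact aux_normal G (x 0) _ hm
end

section
/- Under Assumption 3, there exists a constant c > 0 such that for every θ ∈ G, γ > 0 and y ∈ ℝ^d, the vector λ = (λ_j(θ,γ,y))_{j∈A(P_G[θ+γy])} of the unique nonnegative multipliers in the decomposition −(P_G[θ+γy] − θ − γy)/γ = ∑_{j∈A(P_G[θ+γy])} λ_j ∇q_j(P_G[θ+γy]) satisfies |λ| ≤ c|y|. -/
open Metric

/-- Under Assumption 3, there is a constant `c > 0` such that for every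
`θ ∈ G`, `γ > 0` and `y ∈ ℝ^d`, the (unique) nonnegative multipliers `λ` of the
decomposition `-(P_G[θ+γy] - θ - γy)/γ = ∑_{j active} λ_j ∇q_j(P_G[θ+γy])` satisfy
`|λ| ≤ c |y|`. -/
theorem stmt_8 {d p : ℕ} (hd : 0 < d) (hp : 0 < p)
    (q : Fin p → EuclideanSpace ℝ (Fin d) → ℝ)
    (G : Set (EuclideanSpace ℝ (Fin d)))
    (hGdef : G = {x | ∀ j, q j x ≤ 0})
    (hGne : G.Nonempty) (hGcpt : IsCompact G)
    (hqconv : ∀ j, ConvexOn ℝ Set.univ (q j))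
    (hqdiff : ∃ U, IsOpen U ∧ frontier G ⊆ U ∧ ∀ j, ContDiffOn ℝ 1 (q j) U)
    (hqind : ∀ θ ∈ frontier G,
      LinearIndependent ℝ (fun j : {j : Fin p // q j θ = 0} => gradient (q j.1) θ))
    -- the Euclidean projection onto `G`
    (projG : EuclideanSpace ℝ (Fin d) → EuclideanSpace ℝ (Fin d))
    (hprojG : ∀ x, projG x ∈ G ∧ ∀ u ∈ G, dist x (projG x) ≤ dist x u) :
    ∃ c > (0 : ℝ), ∀ θ ∈ G, ∀ γ : ℝ, 0 < γ → ∀ y : EuclideanSpace ℝ (Fin d),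
      ∀ lam : Fin p → ℝ, (∀ j, 0 ≤ lam j) →
        (∀ j, q j (projG (θ + γ • y)) ≠ 0 → lam j = 0) →
        -(γ⁻¹ • (projG (θ + γ • y) - θ - γ • y)) =
          ∑ j, lam j • gradient (q j) (projG (θ + γ • y)) →
        Real.sqrt (∑ j, lam j ^ 2) ≤ c * ‖y‖ := by
  obtain ⟨U, hUo, hGU, hU⟩ := hqdiff
  have hGcl : IsClosed G := hGcpt.isClosed
  have hfrG : frontier G ⊆ G := hGcl.frontier_subset
  have hfrc : IsCompact (frontier G) := hGcpt.of_isClosed_subset isClosed_frontier hfrG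
  have : Nonempty (Fin d) := ⟨⟨0, hd⟩⟩
  have hgc : ∀ j, ContinuousOn (gradient (q j)) U := by
    intro j
    have h := (hU j).continuousOn_fderiv_of_isOpen hUo le_rfl
    exact (InnerProductSpace.toDual ℝ (EuclideanSpace ℝ (Fin d))).symm.continuous.comp_continuousOn h
  have hqc : ∀ j, ContinuousOn (q j) (frontier G) := fun j => (hU j).continuousOn.mono hGU
  -- interior points have no active constraints
  have hint : ∀ x ∈ interior G, ∀ j, q j x ≠ 0 := by
    intro x hx j hj
    have hnonneg : ∀ u, 0 ≤ q j u := by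
      intro u
      have hcont : Filter.Tendsto (fun t : ℝ => x - t • (u - x)) (nhds 0) (nhds x) := by
        have : Continuous (fun t : ℝ => x - t • (u - x)) := by fun_prop
        simpa using this.tendsto 0
      have hev := hcont.eventually (mem_interior_iff_mem_nhds.1 hx)
      obtain ⟨ε, hε, hball⟩ := Metric.eventually_nhds_iff.1 hev
      have hw : x - (ε / 2) • (u - x) ∈ G := by
        apply hball
        rw [Real.dist_eq, sub_zero, abs_of_pos (by positivity)]
        linarith
      set t := ε / 2 with ht
      have htpos : 0 < t := by positivity
      have hqw : q j (x - t • (u - x)) ≤ 0 := by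
        rw [hGdef] at hw
        exact hw j
      have ha : 0 ≤ t / (1 + t) := by positivity
      have hb : 0 ≤ 1 / (1 + t) := by positivity
      have hab : t / (1 + t) + 1 / (1 + t) = 1 := by field_simp; ring
      have hcv := (hqconv j).2 (Set.mem_univ u) (Set.mem_univ (x - t • (u - x))) ha hb hab
      have hx' : (t / (1 + t)) • u + (1 / (1 + t)) • (x - t • (u - x)) = x := by
        have h1 : 1 + t ≠ 0 := by positivity
        ext i
        simp
        field_simp
        ring
      rw [hx', hj] at hcv
      simp only [smul_eq_mul] at hcv
      have h3 : 1 / (1 + t) * q j (x - t • (u - x)) ≤ 0 :=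
        mul_nonpos_of_nonneg_of_nonpos (by positivity) hqw
      have h4 : 0 ≤ t / (1 + t) * q j u := by linarith
      exact nonneg_of_mul_nonneg_right h4 (by positivity)
    have hne : (frontier G).Nonempty := by
      apply nonempty_frontier_iff.2
      exact ⟨hGne, hGcpt.ne_univ⟩
    obtain ⟨z, hz⟩ := hne
    have hz0 : q j z = 0 := by
      have h := hfrG hz
      rw [hGdef] at h
      exact le_antisymm (h j) (hnonneg z)
    have hmin : IsLocalMin (q j) z := Filter.Eventually.of_forall (fun u => by
      rw [hz0]; exact hnonneg u)
    have hg : gradient (q j) z = 0 := by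
      unfold gradient
      rw [hmin.fderiv_eq_zero, map_zero]
    exact (hqind z hz).ne_zero ⟨j, hz0⟩ hg
  -- uniform lower bound
  have hkey : ∃ m > (0 : ℝ), ∀ x ∈ frontier G, ∀ l : EuclideanSpace ℝ (Fin p),
      ‖l‖ = 1 → (∀ j, l j * q j x = 0) → m ≤ ‖∑ j, l j • gradient (q j) x‖ := by
    let S : Set (EuclideanSpace ℝ (Fin d) × EuclideanSpace ℝ (Fin p)) :=
      frontier G ×ˢ sphere 0 1
    have hS : IsCompact S := hfrc.prod (isCompact_sphere _ _)
    let F : EuclideanSpace ℝ (Fin d) × EuclideanSpace ℝ (Fin p) → Fin p → ℝ :=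
      fun z j => z.2 j * q j z.1
    have hmaps : Set.MapsTo Prod.fst S (frontier G) := fun z hz => hz.1
    have hF : ContinuousOn F S := by
      apply continuousOn_pi.2
      intro j
      apply ContinuousOn.mul
      · fun_prop
      · exact (hqc j).comp continuousOn_fst hmaps
    have hK : IsCompact (S ∩ F ⁻¹' {0}) :=
      hS.of_isClosed_subset (hF.preimage_isClosed_of_isClosed hS.isClosed isClosed_singleton)
        Set.inter_subset_left
    have hH : ContinuousOn (fun z : EuclideanSpace ℝ (Fin d) × EuclideanSpace ℝ (Fin p) =>
        ‖∑ j, z.2 j • gradient (q j) z.1‖) (S ∩ F ⁻¹' {0}) := by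
      apply ContinuousOn.norm
      apply continuousOn_finsetSum
      intro j _
      have h1 : ContinuousOn (fun z : EuclideanSpace ℝ (Fin d) × EuclideanSpace ℝ (Fin p) =>
          z.2 j) (S ∩ F ⁻¹' {0}) := by fun_prop
      exact h1.smul ((hgc j).comp continuousOn_fst (fun z hz => hGU hz.1.1))
    rcases (S ∩ F ⁻¹' {0}).eq_empty_or_nonempty with hem | hne
    · refine ⟨1, one_pos, fun x hx l hl hact => ?_⟩
      exfalso
      have : (x, l) ∈ S ∩ F ⁻¹' {0} := ⟨⟨hx, by simpa using hl⟩, funext hact⟩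
      rw [hem] at this
      exact this
    · obtain ⟨z, hz, hzm⟩ := hK.exists_isMinOn hne hH
      refine ⟨_, ?_, fun x hx l hl hact => hzm (a := (x, l)) ⟨⟨hx, by simpa using hl⟩, funext hact⟩⟩
      apply norm_pos_iff.2
      intro h0
      have hact : ∀ j, z.2 j * q j z.1 = 0 := fun j => congrFun hz.2 j
      have hli := hqind z.1 hz.1.1
      classical
      have hsum : ∑ j : {j : Fin p // q j z.1 = 0}, z.2 j.1 • gradient (q j.1) z.1 = 0 := by
        rw [← h0]
        symm
        rw [← Finset.sum_filter_add_sum_filter_not Finset.univ (fun j => q j z.1 = 0)]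
        rw [Finset.sum_eq_zero (s := Finset.univ.filter (fun j => ¬ q j z.1 = 0)), add_zero]
        · exact Finset.sum_subtype _ (by simp) _
        · intro j hj
          have hj' : q j z.1 ≠ 0 := by simpa using hj
          rw [(mul_eq_zero.1 (hact j)).resolve_right hj', zero_smul]
      have hz2 := Fintype.linearIndependent_iff.1 hli (fun j => z.2 j.1) hsum
      have hzz : z.2 = 0 := by
        ext j
        rcases mul_eq_zero.1 (hact j) with h | h
        · simpa using h
        · simpa using hz2 ⟨j, h⟩
      have := hz.1.2
      rw [hzz] at this
      simp at this
  obtain ⟨m, hm, hbd⟩ := hkey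
  refine ⟨m⁻¹, inv_pos.2 hm, ?_⟩
  intro θ hθ γ hγ y lam _ hlam heq
  obtain ⟨hxG, hxmin⟩ := hprojG (θ + γ • y)
  set x := projG (θ + γ • y) with hx
  have hnorm : ‖∑ j, lam j • gradient (q j) x‖ ≤ ‖y‖ := by
    rw [← heq, norm_neg, norm_smul, Real.norm_of_nonneg (inv_pos.2 hγ).le]
    have h := hxmin θ hθ
    rw [dist_comm, dist_eq_norm, dist_eq_norm, add_sub_cancel_left, norm_smul,
      Real.norm_of_nonneg hγ.le, ← sub_sub] at h
    rw [inv_mul_le_iff₀ hγ]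
    exact h
  by_cases hxi : x ∈ interior G
  · have h0 : ∀ j, lam j = 0 := fun j => hlam j (hint x hxi j)
    simp only [h0]
    simp
    positivity
  · have hxf : x ∈ frontier G := by
      rw [hGcl.frontier_eq]; exact ⟨hxG, hxi⟩
    let l : EuclideanSpace ℝ (Fin p) := WithLp.toLp 2 lam
    have hl : Real.sqrt (∑ j, lam j ^ 2) = ‖l‖ := by
      rw [EuclideanSpace.norm_eq]
      simp [l]
    rw [hl]
    rcases eq_or_ne l 0 with h0 | h0
    · rw [h0, norm_zero]; positivity
    · have hlp : 0 < ‖l‖ := norm_pos_iff.2 h0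
      have h := hbd x hxf (‖l‖⁻¹ • l) (by
        rw [norm_smul, norm_inv, norm_norm, inv_mul_cancel₀ hlp.ne']) (by
        intro j
        by_cases hj : q j x = 0
        · simp [hj]
        · simp [l, hlam j hj])
      have h2 : ∑ j, (‖l‖⁻¹ • l) j • gradient (q j) x
          = ‖l‖⁻¹ • ∑ j, lam j • gradient (q j) x := by
        rw [Finset.smul_sum]
        apply Finset.sum_congr rfl
        intro j _
        simp [l, mul_smul]
      rw [h2, norm_smul, norm_inv, norm_norm, le_inv_mul_iff₀ hlp] at h
      rw [le_inv_mul_iff₀ hm]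
      linarith
end

section
/- Under Assumption 3, define for θ ∈ G the quantity Λ₁(θ) as the smallest eigenvalue of Q(θ)ᵀQ(θ), where Q(θ) is the d × |A(θ)| matrix whose columns are (∇q_j(θ))_{j∈A(θ)} (with the convention Λ₁(θ) = +∞ when A(θ) = ∅). Then Λ₁ is lower semicontinuous on G: for every sequence θ_n ∈ G converging to θ* ∈ G, Λ₁(θ*) ≤ liminf_n Λ₁(θ_n). Consequently, there exists m > 0 such that Λ₁(θ) ≥ m for all θ ∈ G. -/
open Filter

/-- `Λ₁(θ)`: the smallest eigenvalue of `Q(θ)ᵀQ(θ)` where the columns of `Q(θ)` are the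
gradients `∇q_j(θ)` for `j` in the active set `A(θ) = {j : q_j(θ) = 0}`, expressed
variationally as the infimum of `‖∑_j v_j ∇q_j(θ)‖²` over unit vectors `v` supported on
`A(θ)` (in `ℝ≥0∞`, so that `Λ₁(θ) = ∞` when `A(θ) = ∅`). -/
noncomputable def Lam1 {d p : ℕ} (q : Fin p → EuclideanSpace ℝ (Fin d) → ℝ)
    (θ : EuclideanSpace ℝ (Fin d)) : ENNReal :=
  sInf {e : ENNReal | ∃ v : Fin p → ℝ, (∀ j, q j θ ≠ 0 → v j = 0) ∧ (∑ j, v j ^ 2 = 1) ∧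
    e = ENNReal.ofReal (‖∑ j, v j • gradient (q j) θ‖ ^ 2)}


lemma aux_cont {d : ℕ} {f : EuclideanSpace ℝ (Fin d) → ℝ} (hf : ConvexOn ℝ Set.univ f) :
    Continuous f := by
  have := hf.continuousOn isOpen_univ
  exact continuousOn_univ.mp this

lemma aux_frontier {d p : ℕ} (hd : 0 < d)
    (q : Fin p → EuclideanSpace ℝ (Fin d) → ℝ)
    (G : Set (EuclideanSpace ℝ (Fin d)))
    (hGdef : G = {x | ∀ j, q j x ≤ 0})
    (hGne : G.Nonempty) (hGcpt : IsCompact G)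
    (hqconv : ∀ j, ConvexOn ℝ Set.univ (q j))
    (hqind : ∀ θ ∈ frontier G,
      LinearIndependent ℝ (fun j : {j : Fin p // q j θ = 0} => gradient (q j.1) θ))
    (θ : EuclideanSpace ℝ (Fin d)) (hθ : θ ∈ G) (j : Fin p) (hj : q j θ = 0) :
    θ ∈ frontier G := by
  have hcl : IsClosed G := hGcpt.isClosed
  rw [hcl.frontier_eq]
  refine ⟨hθ, fun hint => ?_⟩
  have hle : ∀ x ∈ G, ∀ i, q i x ≤ 0 := by
    intro x hx; rw [hGdef] at hx; exact hx
  have hnh : G ∈ nhds θ := mem_interior_iff_mem_nhds.mp hint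
  -- a local minimum, hence a global one
  have hmin : ∀ y, q j θ ≤ q j y := by
    refine IsMinOn.of_isLocalMin_of_convex_univ (f := q j) (a := θ) ?_ (hqconv j)
    have ht : Tendsto (fun x : EuclideanSpace ℝ (Fin d) => (2:ℝ) • θ - x) (nhds θ) (nhds θ) := by
      have h : Continuous (fun x : EuclideanSpace ℝ (Fin d) => (2:ℝ) • θ - x) := by fun_prop
      have h2 := h.tendsto θ
      have h3 : (2:ℝ) • θ - θ = θ := by rw [two_smul]; abel
      rwa [h3] at h2
    filter_upwards [ht hnh] with x hx
    have h1 := hle _ hx j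
    have h2 := (hqconv j).2 (Set.mem_univ x) (Set.mem_univ ((2:ℝ) • θ - x))
      (by norm_num : (0:ℝ) ≤ 1/2) (by norm_num : (0:ℝ) ≤ 1/2) (by norm_num)
    have h3 : (1/2:ℝ) • x + (1/2:ℝ) • ((2:ℝ) • θ - x) = θ := by
      rw [smul_sub, smul_smul]; norm_num
    rw [h3] at h2
    simp only [smul_eq_mul] at h2
    linarith
  have : Nonempty (Fin d) := ⟨⟨0, hd⟩⟩
  have hne : (frontier G).Nonempty := by
    apply nonempty_frontier_iff.mpr
    refine ⟨hGne, fun h => ?_⟩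
    rw [h] at hGcpt
    exact noncompact_univ _ hGcpt
  obtain ⟨y, hy⟩ := hne
  have hyG : y ∈ G := hcl.frontier_subset hy
  have hy0 : q j y = 0 := le_antisymm (hle y hyG j) (hj ▸ hmin y)
  have hlm : IsLocalMin (q j) y := by
    refine Eventually.of_forall fun x => ?_
    rw [hy0, ← hj]; exact hmin x
  have hg : gradient (q j) y = 0 := by
    unfold gradient
    rw [hlm.fderiv_eq_zero]; simp
  exact (hqind y hy).ne_zero ⟨j, hy0⟩ hg

lemma aux_key {d p : ℕ} (hd : 0 < d)
    (q : Fin p → EuclideanSpace ℝ (Fin d) → ℝ)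
    (G : Set (EuclideanSpace ℝ (Fin d)))
    (hGdef : G = {x | ∀ j, q j x ≤ 0})
    (hGne : G.Nonempty) (hGcpt : IsCompact G)
    (hqconv : ∀ j, ConvexOn ℝ Set.univ (q j))
    (hqdiff : ∃ U, IsOpen U ∧ frontier G ⊆ U ∧ ∀ j, ContDiffOn ℝ 1 (q j) U)
    (hqind : ∀ θ ∈ frontier G,
      LinearIndependent ℝ (fun j : {j : Fin p // q j θ = 0} => gradient (q j.1) θ))
    (u : ℕ → EuclideanSpace ℝ (Fin d)) (θs : EuclideanSpace ℝ (Fin d)) (hθ : θs ∈ G)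
    (hu : Tendsto u atTop (nhds θs)) (v : ℕ → Fin p → ℝ)
    (hv : ∀ n j, q j (u n) ≠ 0 → v n j = 0) (hv1 : ∀ n, ∑ j, v n j ^ 2 = 1) :
    ∃ w : Fin p → ℝ, (∀ j, q j θs ≠ 0 → w j = 0) ∧ (∑ j, w j ^ 2 = 1) ∧ θs ∈ frontier G ∧
      ∃ φ : ℕ → ℕ, StrictMono φ ∧
      Tendsto (fun n => ‖∑ j, v (φ n) j • gradient (q j) (u (φ n))‖ ^ 2) atTop
        (nhds (‖∑ j, w j • gradient (q j) θs‖ ^ 2)) := by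
  have hK : IsCompact (Set.Icc (fun _ : Fin p => (-1:ℝ)) (fun _ => 1)) := isCompact_Icc
  have hvK : ∀ n, v n ∈ Set.Icc (fun _ : Fin p => (-1:ℝ)) (fun _ => 1) := by
    intro n
    have : ∀ j, -1 ≤ v n j ∧ v n j ≤ 1 := by
      intro j
      apply abs_le.mp
      rw [← sq_le_one_iff_abs_le_one, ← hv1 n]
      exact Finset.single_le_sum (f := fun j => v n j ^ 2) (fun i _ => sq_nonneg _)
        (Finset.mem_univ j)
    exact ⟨fun j => (this j).1, fun j => (this j).2⟩
  obtain ⟨w, -, φ, hφ, hw⟩ := hK.tendsto_subseq hvK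
  have huφ : Tendsto (fun n => u (φ n)) atTop (nhds θs) := hu.comp hφ.tendsto_atTop
  have hwj : ∀ j, Tendsto (fun n => v (φ n) j) atTop (nhds (w j)) := fun j =>
    (tendsto_pi_nhds.mp hw) j
  have hsupp : ∀ j, q j θs ≠ 0 → w j = 0 := by
    intro j hj
    have h1 : Tendsto (fun n => q j (u (φ n))) atTop (nhds (q j θs)) :=
      ((aux_cont (hqconv j)).tendsto θs).comp huφ
    have h2 := h1.eventually_ne hj
    refine tendsto_nhds_unique (hwj j) (tendsto_const_nhds.congr' ?_)
    filter_upwards [h2] with n hn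
    exact (hv _ j hn).symm
  have hsum : ∑ j, w j ^ 2 = 1 := by
    have h1 : Tendsto (fun n => ∑ j, v (φ n) j ^ 2) atTop (nhds (∑ j, w j ^ 2)) :=
      tendsto_finsetSum _ fun j _ => (hwj j).pow 2
    simp only [hv1] at h1
    exact (tendsto_nhds_unique h1 tendsto_const_nhds)
  have hfr : θs ∈ frontier G := by
    have : ∃ j, q j θs = 0 := by
      by_contra! hcon
      have : ∑ j, w j ^ 2 = 0 := Finset.sum_eq_zero fun j _ => by rw [hsupp j (hcon j)]; simp
      rw [this] at hsum
      exact zero_ne_one hsum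
    obtain ⟨j, hj⟩ := this
    exact aux_frontier hd q G hGdef hGne hGcpt hqconv hqind θs hθ j hj
  refine ⟨w, hsupp, hsum, hfr, φ, hφ, ?_⟩
  obtain ⟨U, hUo, hUf, hUd⟩ := hqdiff
  have hgr : ∀ j, ContinuousAt (gradient (q j)) θs := by
    intro j
    have h1 : ContinuousAt (fderiv ℝ (q j)) θs :=
      ((hUd j).continuousOn_fderiv_of_isOpen hUo le_rfl).continuousAt (hUo.mem_nhds (hUf hfr))
    unfold gradient
    exact (LinearIsometryEquiv.continuous _).continuousAt.comp h1
  refine Tendsto.pow (Tendsto.norm ?_) 2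
  exact tendsto_finsetSum _ fun j _ => (hwj j).smul ((hgr j).tendsto.comp huφ)

lemma aux_ex {d p : ℕ} {q : Fin p → EuclideanSpace ℝ (Fin d) → ℝ}
    {θ : EuclideanSpace ℝ (Fin d)} {c : ENNReal} (h : Lam1 q θ < c) :
    ∃ v : Fin p → ℝ, (∀ j, q j θ ≠ 0 → v j = 0) ∧ (∑ j, v j ^ 2 = 1) ∧
      ENNReal.ofReal (‖∑ j, v j • gradient (q j) θ‖ ^ 2) < c := by
  obtain ⟨e, ⟨v, h1, h2, rfl⟩, h3⟩ := sInf_lt_iff.mp h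
  exact ⟨v, h1, h2, h3⟩

/-- Under Assumption 3, `Λ₁` is lower semicontinuous along sequences in
`G`, and is bounded below on `G` by some `m > 0`. -/
theorem stmt_9 {d p : ℕ} (hd : 0 < d) (hp : 0 < p)
    (q : Fin p → EuclideanSpace ℝ (Fin d) → ℝ)
    (G : Set (EuclideanSpace ℝ (Fin d)))
    (hGdef : G = {x | ∀ j, q j x ≤ 0})
    (hGne : G.Nonempty) (hGcpt : IsCompact G)
    (hqconv : ∀ j, ConvexOn ℝ Set.univ (q j))
    (hqdiff : ∃ U, IsOpen U ∧ frontier G ⊆ U ∧ ∀ j, ContDiffOn ℝ 1 (q j) U)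
    (hqind : ∀ θ ∈ frontier G,
      LinearIndependent ℝ (fun j : {j : Fin p // q j θ = 0} => gradient (q j.1) θ)) :
    (∀ u : ℕ → EuclideanSpace ℝ (Fin d), ∀ θs ∈ G, (∀ n, u n ∈ G) →
      Tendsto u atTop (nhds θs) →
      Lam1 q θs ≤ liminf (fun n => Lam1 q (u n)) atTop) ∧
    ∃ m : ℝ, 0 < m ∧ ∀ θ ∈ G, ENNReal.ofReal m ≤ Lam1 q θ := by
  constructor
  · intro u θs hθ huG hu
    by_contra! hlt
    obtain ⟨c, hc1, hc2⟩ := exists_between hlt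
    have hfreq := frequently_lt_of_liminf_lt (by isBoundedDefault) hc1
    obtain ⟨ψ, hψ, hψc⟩ := extraction_of_frequently_atTop hfreq
    choose v hv hv1 hvc using fun n => aux_ex (hψc n)
    obtain ⟨w, hw, hw1, -, φ, hφ, hlim⟩ := aux_key hd q G hGdef hGne hGcpt hqconv hqdiff hqind
      (fun n => u (ψ n)) θs hθ (hu.comp hψ.tendsto_atTop) v hv hv1
    have h1 : Lam1 q θs ≤ ENNReal.ofReal (‖∑ j, w j • gradient (q j) θs‖ ^ 2) :=
      sInf_le ⟨w, hw, hw1, rfl⟩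
    have h2 : ENNReal.ofReal (‖∑ j, w j • gradient (q j) θs‖ ^ 2) ≤ c :=
      le_of_tendsto' (ENNReal.tendsto_ofReal hlim) fun n => (hvc (φ n)).le
    exact absurd (h1.trans h2) (not_le.mpr hc2)
  · by_contra! hcon
    choose t htG ht using fun n : ℕ => hcon (1 / ((n:ℝ) + 1)) (by positivity)
    obtain ⟨θs, hθ, ψ, hψ, hu⟩ := hGcpt.tendsto_subseq htG
    choose v hv hv1 hvc using fun n => aux_ex (ht (ψ n))
    obtain ⟨w, hw, hw1, hfr, φ, hφ, hlim⟩ := aux_key hd q G hGdef hGne hGcpt hqconv hqdiff hqind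
      (fun n => t (ψ n)) θs hθ hu v hv hv1
    have h0 : Tendsto (fun n => 1 / (((ψ (φ n) : ℕ) : ℝ) + 1)) atTop (nhds 0) :=
      (tendsto_one_div_add_atTop_nhds_zero_nat (𝕜 := ℝ)).comp
        (hψ.tendsto_atTop.comp hφ.tendsto_atTop)
    have h1 : ‖∑ j, w j • gradient (q j) θs‖ ^ 2 ≤ 0 := by
      refine le_of_tendsto_of_tendsto' hlim h0 fun n => ?_
      exact ((ENNReal.ofReal_lt_ofReal_iff (by positivity)).mp (hvc (φ n))).le
    have h2 : ∑ j, w j • gradient (q j) θs = 0 := by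
      have h3 := le_antisymm h1 (sq_nonneg _)
      simpa using h3
    have h3 : ∑ j : {j : Fin p // q j θs = 0}, w j.1 • gradient (q j.1) θs = 0 := by
      rw [← h2]
      classical
      rw [← Finset.sum_subtype (Finset.univ.filter fun j => q j θs = 0) (by simp)
        (fun j => w j • gradient (q j) θs)]
      refine Finset.sum_filter_of_ne ?_
      · intro j _ hj
        by_contra hq
        exact hj (by rw [hw j hq, zero_smul])
    have h4 := Fintype.linearIndependent_iff.mp (hqind θs hfr) (fun j => w j.1) h3
    have h5 : ∑ j, w j ^ 2 = 0 := Finset.sum_eq_zero fun j _ => by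
      by_cases hj : q j θs = 0
      · have := h4 ⟨j, hj⟩
        simp only at this
        rw [this]; simp
      · rw [hw j hj]; simp
    rw [h5] at hw1
    exact zero_ne_one hw1
end

section
/- Under Assumption 3, there exist a function δ : [0,∞) → [0,∞) with δ(ε) → 0 as ε ↓ 0 and a constant ε₀ > 0 such that for every 0 < ε < ε₀ and every θ ∈ G, there exists θ' ∈ G with |θ − θ'| < δ(ε) and 𝒜(θ,ε) ⊆ A(θ'). -/
open Filter

/-- Under Assumption 3, there are `δ : [0,∞) → [0,∞)` with `δ(ε) → 0`
as `ε ↓ 0` and `ε₀ > 0` such that for every `0 < ε < ε₀` and `θ ∈ G` there is `θ' ∈ G`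
with `|θ - θ'| < δ(ε)` and `𝒜(θ, ε) ⊆ A(θ')`, where
`𝒜(θ, ε) = {j : dist(θ, q_j⁻¹({0})) ≤ ε}` and `A(θ') = {j : q_j(θ') = 0}`. -/
theorem stmt_11 {d p : ℕ} (hd : 0 < d) (hp : 0 < p)
    (q : Fin p → EuclideanSpace ℝ (Fin d) → ℝ)
    (G : Set (EuclideanSpace ℝ (Fin d)))
    (hGdef : G = {x | ∀ j, q j x ≤ 0})
    (hGne : G.Nonempty) (hGcpt : IsCompact G)
    (hqconv : ∀ j, ConvexOn ℝ Set.univ (q j))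
    (hqdiff : ∃ U, IsOpen U ∧ frontier G ⊆ U ∧ ∀ j, ContDiffOn ℝ 1 (q j) U)
    (hqind : ∀ θ ∈ frontier G,
      LinearIndependent ℝ (fun j : {j : Fin p // q j θ = 0} => gradient (q j.1) θ)) :
    ∃ δ : ℝ → ℝ, (∀ x, 0 ≤ δ x) ∧
      Tendsto δ (nhdsWithin 0 (Set.Ioi 0)) (nhds 0) ∧
      ∃ ε₀ > (0 : ℝ), ∀ ε : ℝ, 0 < ε → ε < ε₀ → ∀ θ ∈ G, ∃ θ' ∈ G,
        ‖θ - θ'‖ < δ ε ∧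
        ∀ j : Fin p, EMetric.infEdist θ (q j ⁻¹' {0}) ≤ ENNReal.ofReal ε → q j θ' = 0 := by
  have hcont : ∀ j, Continuous (q j) := fun j => by
    rw [← continuousOn_univ]
    exact (hqconv j).continuousOn isOpen_univ
  set P : ℝ → ℝ → Prop := fun η e => ∀ θ ∈ G, ∃ θ' ∈ G, ‖θ - θ'‖ < η ∧
    ∀ j : Fin p, EMetric.infEdist θ (q j ⁻¹' {0}) ≤ ENNReal.ofReal e → q j θ' = 0 with hP
  have hmono : ∀ η e e', e' ≤ e → P η e → P η e' := by
    intro η e e' he h θ hθ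
    obtain ⟨θ', h1, h2, h3⟩ := h θ hθ
    exact ⟨θ', h1, h2, fun j hj => h3 j (hj.trans (ENNReal.ofReal_le_ofReal he))⟩
  have key : ∀ η > 0, ∃ e > 0, P η e := by
    intro η hη
    refine hGcpt.induction_on (p := fun s => ∃ e > 0, ∀ θ ∈ s, ∃ θ' ∈ G, ‖θ - θ'‖ < η ∧
      ∀ j : Fin p, EMetric.infEdist θ (q j ⁻¹' {0}) ≤ ENNReal.ofReal e → q j θ' = 0)
      ?_ ?_ ?_ ?_
    · exact ⟨1, one_pos, by simp⟩
    · rintro s t hst ⟨e, he, h⟩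
      exact ⟨e, he, fun θ hθ => h θ (hst hθ)⟩
    · rintro s t ⟨e, he, h⟩ ⟨e', he', h'⟩
      refine ⟨min e e', lt_min he he', ?_⟩
      rintro θ (hθ | hθ)
      · obtain ⟨θ', h1, h2, h3⟩ := h θ hθ
        exact ⟨θ', h1, h2, fun j hj =>
          h3 j (hj.trans (ENNReal.ofReal_le_ofReal (min_le_left _ _)))⟩
      · obtain ⟨θ', h1, h2, h3⟩ := h' θ hθ
        exact ⟨θ', h1, h2, fun j hj =>
          h3 j (hj.trans (ENNReal.ofReal_le_ofReal (min_le_right _ _)))⟩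
    · intro x hx
      have hev : ∀ᶠ c in nhdsWithin (0 : ℝ) (Set.Ioi 0), ∀ j, q j x ≠ 0 →
          ENNReal.ofReal c < EMetric.infEdist x (q j ⁻¹' {0}) := by
        rw [eventually_all]
        intro j
        by_cases hj : q j x = 0
        · simp [hj]
        · have hcl : IsClosed (q j ⁻¹' {0}) := isClosed_singleton.preimage (hcont j)
          have hpos : 0 < EMetric.infEdist x (q j ⁻¹' {0}) := by
            rw [pos_iff_ne_zero]
            intro h0
            exact hj ((EMetric.mem_iff_infEdist_zero_of_closed hcl).2 h0)
          have ht : Tendsto ENNReal.ofReal (nhdsWithin (0 : ℝ) (Set.Ioi 0)) (nhds 0) := by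
            have := (ENNReal.continuous_ofReal.tendsto 0).mono_left
              (nhdsWithin_le_nhds (s := Set.Ioi (0 : ℝ)))
            simpa using this
          filter_upwards [ht.eventually (gt_mem_nhds hpos)] with c hc _ using hc
      obtain ⟨c, hc, hc0⟩ := (hev.and self_mem_nhdsWithin).exists
      have hc0 : 0 < c := hc0
      refine ⟨Metric.ball x (min η (c / 2)), mem_nhdsWithin_of_mem_nhds
        (Metric.ball_mem_nhds _ (lt_min hη (half_pos hc0))), c / 2, half_pos hc0, ?_⟩
      intro θ hθ
      have hθ' : dist θ x < min η (c / 2) := hθ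
      refine ⟨x, hx, ?_, ?_⟩
      · rw [← dist_eq_norm]
        exact hθ'.trans_le (min_le_left _ _)
      · intro j hj
        by_contra hne
        refine absurd (hc j hne) (not_lt.2 ?_)
        calc EMetric.infEdist x (q j ⁻¹' {0})
            ≤ EMetric.infEdist θ (q j ⁻¹' {0}) + edist x θ :=
              EMetric.infEdist_le_infEdist_add_edist
          _ ≤ ENNReal.ofReal (c / 2) + ENNReal.ofReal (c / 2) := by
              refine add_le_add hj ?_
              rw [edist_dist, dist_comm]
              exact ENNReal.ofReal_le_ofReal (hθ'.le.trans (min_le_right _ _))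
          _ = ENNReal.ofReal c := by
              rw [← ENNReal.ofReal_add (half_pos hc0).le (half_pos hc0).le, add_halves]
  have hbdd : ∀ e, BddBelow {η | 0 < η ∧ P η e} := fun e => ⟨0, fun η h => h.1.le⟩
  have hinf : ∀ e, 0 ≤ sInf {η | 0 < η ∧ P η e} := fun e => Real.sInf_nonneg fun η h => h.1.le
  refine ⟨fun e => sInf {η | 0 < η ∧ P η e} + |e|,
    fun e => add_nonneg (hinf e) (abs_nonneg e), ?_, ?_⟩
  · rw [Metric.tendsto_nhds]
    intro η hη
    obtain ⟨e, he, h⟩ := key (η / 2) (half_pos hη)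
    filter_upwards [Ioo_mem_nhdsGT (lt_min he (half_pos hη))] with x hx
    have h1 : sInf {η | 0 < η ∧ P η x} ≤ η / 2 :=
      csInf_le (hbdd x) ⟨half_pos hη, hmono _ _ _ (hx.2.le.trans (min_le_left _ _)) h⟩
    have h2 : x < η / 2 := hx.2.trans_le (min_le_right _ _)
    have h3 : |x| = x := abs_of_pos hx.1
    rw [Real.dist_eq, sub_zero, abs_of_nonneg (add_nonneg (hinf x) (abs_nonneg x)), h3]
    linarith
  · obtain ⟨e, he, h⟩ := key 1 one_pos
    refine ⟨e, he, fun ε hε hεe θ hθ => ?_⟩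
    have hne : {η | 0 < η ∧ P η ε}.Nonempty := ⟨1, one_pos, hmono _ _ _ hεe.le h⟩
    obtain ⟨η, ⟨_, hη⟩, hlt⟩ := exists_lt_of_csInf_lt hne
      (lt_add_of_pos_right (sInf {η | 0 < η ∧ P η ε}) (abs_pos.2 hε.ne'))
    obtain ⟨θ', h1, h2, h3⟩ := hη θ hθ
    exact ⟨θ', h1, h2.trans hlt, h3⟩
end

section
/- Under Assumption 3, for each j ∈ {1,…,p} and ε ≥ 0 set ∂G_j^ε = {θ ∈ G : ∃θ' ∈ q_j^{-1}({0}), |θ' − θ| ≤ ε}. Then for every subset E ⊆ {1,…,p}, the Hausdorff distance d_H(⋂_{j∈E} ∂G_j^ε, ⋂_{j∈E} ∂G_j^0) converges to 0 as ε ↓ 0 (with the convention d_H(∅,∅) = 0). -/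
open Filter Metric

/-- The `ε`-neighborhood (within `G`) of the zero set of the `j`-th constraint:
`∂G_j^ε = {θ ∈ G : ∃ θ' with q_j(θ') = 0, |θ' - θ| ≤ ε}`. -/
def bdryNbhd {d p : ℕ} (q : Fin p → EuclideanSpace ℝ (Fin d) → ℝ)
    (G : Set (EuclideanSpace ℝ (Fin d))) (j : Fin p) (ε : ℝ) :
    Set (EuclideanSpace ℝ (Fin d)) :=
  {θ ∈ G | ∃ θ', q j θ' = 0 ∧ ‖θ' - θ‖ ≤ ε}

/-- Under Assumption 3, for every `E ⊆ {1,…,p}` the Hausdorff distance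
`d_H(⋂_{j∈E} ∂G_j^ε, ⋂_{j∈E} ∂G_j^0)` converges to `0` as `ε ↓ 0` (Mathlib's
`Metric.hausdorffDist` satisfies the convention `d_H(∅, ∅) = 0`). -/
theorem stmt_12 {d p : ℕ} (hd : 0 < d) (hp : 0 < p)
    (q : Fin p → EuclideanSpace ℝ (Fin d) → ℝ)
    (G : Set (EuclideanSpace ℝ (Fin d)))
    (hGdef : G = {x | ∀ j, q j x ≤ 0})
    (hGne : G.Nonempty) (hGcpt : IsCompact G)
    (hqconv : ∀ j, ConvexOn ℝ Set.univ (q j))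
    (hqdiff : ∃ U, IsOpen U ∧ frontier G ⊆ U ∧ ∀ j, ContDiffOn ℝ 1 (q j) U)
    (hqind : ∀ θ ∈ frontier G,
      LinearIndependent ℝ (fun j : {j : Fin p // q j θ = 0} => gradient (q j.1) θ)) :
    ∀ E : Finset (Fin p),
      Tendsto (fun ε : ℝ =>
          hausdorffDist (⋂ j ∈ E, bdryNbhd q G j ε) (⋂ j ∈ E, bdryNbhd q G j 0))
        (nhdsWithin 0 (Set.Ioi 0)) (nhds 0) := by
  intro E
  rcases E.eq_empty_or_nonempty with rfl | hE
  · simp [hausdorffDist_self_zero]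
  have hcont : ∀ j, Continuous (q j) := fun j => (hqconv j).locallyLipschitz.continuous
  rcases Set.eq_empty_or_nonempty (⋂ j ∈ E, bdryNbhd q G j 0) with h0 | h0
  · simp [h0, hausdorffDist_empty]
  have hmem0 : ∀ j θ, θ ∈ bdryNbhd q G j 0 ↔ θ ∈ G ∧ q j θ = 0 := by
    intro j θ
    constructor
    · rintro ⟨hG, θ', h, hn⟩
      have : θ' = θ := by
        rw [← sub_eq_zero]; exact norm_le_zero_iff.1 hn
      exact ⟨hG, this ▸ h⟩
    · rintro ⟨hG, h⟩
      exact ⟨hG, θ, h, by simp⟩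
  obtain ⟨θ₀, hθ₀⟩ := h0
  have hZne : ∀ j ∈ E, {x | q j x = 0}.Nonempty := fun j hj =>
    ⟨θ₀, ((hmem0 j θ₀).1 (Set.mem_iInter₂.1 hθ₀ j hj)).2⟩
  have hZcl : ∀ j, IsClosed {x | q j x = 0} := fun j => isClosed_eq (hcont j) continuous_const
  rw [Metric.tendsto_nhds]
  intro δ hδ
  have hK : IsCompact (G \ thickening (δ / 2) (⋂ j ∈ E, bdryNbhd q G j 0)) :=
    hGcpt.diff isOpen_thickening
  obtain ⟨m, hm, hmK⟩ := hK.exists_forall_le' (a := 0)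
    (f := fun θ => ∑ j ∈ E, infDist θ {x | q j x = 0})
    (continuous_finset_sum _ fun j _ => continuous_infDist_pt _).continuousOn (by
      rintro θ ⟨hG, hθ⟩
      by_contra hle
      apply hθ
      apply self_subset_thickening (half_pos hδ)
      have hz := (Finset.sum_eq_zero_iff_of_nonneg
        (fun j (_ : j ∈ E) => infDist_nonneg (x := θ) (s := {x | q j x = 0}))).1
        (le_antisymm (not_lt.1 hle) (Finset.sum_nonneg fun j _ => infDist_nonneg))
      refine Set.mem_iInter₂.2 fun j hj => (hmem0 j θ).2 ⟨hG, ?_⟩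
      exact ((hZcl j).mem_iff_infDist_zero (hZne j hj)).2 (hz j hj))
  have hcard : (0 : ℝ) < E.card := by exact_mod_cast hE.card_pos
  filter_upwards [Ioo_mem_nhdsGT (div_pos hm hcard)] with ε hε
  obtain ⟨hε0, hε1⟩ := hε
  rw [lt_div_iff₀ hcard] at hε1
  rw [Real.dist_eq, sub_zero, abs_of_nonneg hausdorffDist_nonneg]
  refine lt_of_le_of_lt ?_ (half_lt_self hδ)
  refine hausdorffDist_le_of_infDist (half_pos hδ).le ?_ ?_
  · intro θ hθ
    rw [Set.mem_iInter₂] at hθ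
    by_contra hlt
    obtain ⟨j₀, hj₀⟩ := hE
    have := hmK θ ⟨(hθ j₀ hj₀).1, fun h => hlt
      ((mem_thickening_iff_infDist_lt ⟨θ₀, hθ₀⟩).1 h).le⟩
    have h2 : ∑ j ∈ E, infDist θ {x | q j x = 0} ≤ ∑ j ∈ E, ε := by
      refine Finset.sum_le_sum fun j hj => ?_
      obtain ⟨_, θ', h, hn⟩ := hθ j hj
      refine (infDist_le_dist_of_mem (show θ' ∈ {x | q j x = 0} from h)).trans ?_
      rwa [dist_comm, dist_eq_norm]
    rw [Finset.sum_const, nsmul_eq_mul] at h2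
    linarith
  · intro θ hθ
    rw [infDist_zero_of_mem]
    · exact (half_pos hδ).le
    rw [Set.mem_iInter₂] at hθ ⊢
    intro j hj
    obtain ⟨hG, h⟩ := (hmem0 j θ).1 (hθ j hj)
    exact ⟨hG, θ, h, by simpa using hε0.le⟩
end

section
/- Let G ⊆ ℝ^d be a nonempty compact convex set, let f : ℝ^d → ℝ be continuously differentiable, fix c > 0, and define F(θ) = {−∇f(θ) − z : z ∈ N_G(θ), |z| ≤ c} for θ ∈ G. Then F is a closed set-valued map on G (the graph {(θ, y) ∈ G × ℝ^d : y ∈ F(θ)} is closed), and for every θ ∈ G the set F(θ) is nonempty, compact and convex. -/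
open Metric
open scoped RealInnerProductSpace

/-- For `G ⊆ ℝ^d` nonempty compact convex, `f` continuously differentiable
and `c > 0`, the map `F(θ) = {-∇f(θ) - z : z ∈ N_G(θ), |z| ≤ c}` is a closed set-valued map
on `G` (its graph over `G` is closed), and each `F(θ)`, `θ ∈ G`, is nonempty, compact and
convex. -/
theorem stmt_14 {d : ℕ} (G : Set (EuclideanSpace ℝ (Fin d)))
    (hGne : G.Nonempty) (hGcpt : IsCompact G) (hGconv : Convex ℝ G)
    (f : EuclideanSpace ℝ (Fin d) → ℝ) (hf : ContDiff ℝ 1 f)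
    (c : ℝ) (hc : 0 < c) :
    IsClosed {p : EuclideanSpace ℝ (Fin d) × EuclideanSpace ℝ (Fin d) |
        p.1 ∈ G ∧ p.2 ∈ Fmap G f c p.1} ∧
    ∀ θ ∈ G, (Fmap G f c θ).Nonempty ∧ IsCompact (Fmap G f c θ) ∧ Convex ℝ (Fmap G f c θ) := by
  have hgc : Continuous (fun θ => gradient f θ) := by
    unfold gradient
    exact (InnerProductSpace.toDual ℝ (EuclideanSpace ℝ (Fin d))).symm.continuous.comp
      (hf.continuous_fderiv one_ne_zero)
  have hmem : ∀ θ w, w ∈ Fmap G f c θ ↔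
      (∀ θ' ∈ G, 0 ≤ ⟪-gradient f θ - w, θ - θ'⟫) ∧ ‖-gradient f θ - w‖ ≤ c := by
    intro θ w
    constructor
    · rintro ⟨z, hz, hzc, rfl⟩
      have h : -gradient f θ - (-gradient f θ - z) = z := by abel
      rw [h]
      exact ⟨hz, hzc⟩
    · rintro ⟨h1, h2⟩
      exact ⟨-gradient f θ - w, h1, h2, by abel⟩
  have hclosed : IsClosed {p : EuclideanSpace ℝ (Fin d) × EuclideanSpace ℝ (Fin d) |
      p.1 ∈ G ∧ p.2 ∈ Fmap G f c p.1} := by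
    have hg1 : Continuous (fun p : EuclideanSpace ℝ (Fin d) × EuclideanSpace ℝ (Fin d) =>
        -gradient f p.1 - p.2) := (hgc.comp continuous_fst).neg.sub continuous_snd
    simp only [hmem, Set.setOf_and, Set.setOf_forall]
    refine (hGcpt.isClosed.preimage continuous_fst).inter (IsClosed.inter ?_ ?_)
    · refine isClosed_iInter fun θ' => isClosed_iInter fun _ => ?_
      exact isClosed_le continuous_const (hg1.inner (continuous_fst.sub continuous_const))
    · exact isClosed_le hg1.norm continuous_const
  refine ⟨hclosed, fun θ hθ => ⟨?_, ?_, ?_⟩⟩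
  · exact ⟨-gradient f θ - 0, 0, fun θ' _ => by simp, by simpa using hc.le, rfl⟩
  · refine (isCompact_closedBall (-gradient f θ) c).of_isClosed_subset ?_ ?_
    · have h := hclosed.preimage (Continuous.prodMk_right θ)
      have e : (Prod.mk θ) ⁻¹' {p : EuclideanSpace ℝ (Fin d) × EuclideanSpace ℝ (Fin d) |
          p.1 ∈ G ∧ p.2 ∈ Fmap G f c p.1} = Fmap G f c θ := by
        ext w
        simp [hθ]
      rwa [e] at h
    · intro w hw
      rw [mem_closedBall', dist_eq_norm]
      exact ((hmem θ w).1 hw).2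
  · rintro _ ⟨z, hz, hzc, rfl⟩ _ ⟨y, hy, hyc, rfl⟩ a b ha hb hab
    refine ⟨a • z + b • y, fun θ' hθ' => ?_, ?_, ?_⟩
    · rw [inner_add_left, real_inner_smul_left, real_inner_smul_left]
      exact add_nonneg (mul_nonneg ha (hz θ' hθ')) (mul_nonneg hb (hy θ' hθ'))
    · have h := convex_closedBall (0 : EuclideanSpace ℝ (Fin d)) c
        (mem_closedBall_zero_iff.2 hzc) (mem_closedBall_zero_iff.2 hyc) ha hb hab
      exact mem_closedBall_zero_iff.1 h
    · obtain rfl : b = 1 - a := by linarith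
      module
end

section
/- Let (v_n)_{n≥0} be a sequence of nonnegative reals, (γ_n)_{n≥1} a sequence of positive reals, and (ρ_n)_{n≥1} a sequence of nonnegative reals, satisfying v_n ≤ ρ_n v_{n−1} + γ_n √(v_{n−1}) + γ_n² for every n ≥ 1. Assume n(1 − ρ_n) → +∞ as n → ∞, and that there exists α > 1/2 with n^α γ_n → 0 and liminf_n (1 − ρ_n)/(n^α γ_n) > 0. Then the sequence (n^{2α} v_n)_{n≥1} is bounded; in particular ∑_{n≥1} v_n < ∞. -/
open Filter

theorem step_aux {c S g δ y : ℝ} (hc : 0 < c) (hS1 : 1 ≤ S) (hSc : 6 / c ≤ S) (hg : 0 < g)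
    (hg1 : g ≤ 1) (hcg : c * g ≤ δ) (hδ0 : 0 < δ) (hδ1 : δ ≤ 1) (hy : 0 ≤ y)
    (hx : y ^ 2 * (1 - δ / 4) ≤ S ^ 2) :
    (1 - δ) * y ^ 2 + g * y + g ^ 2 ≤ S ^ 2 := by
  have hyS : y ≤ 2 * S := by
    refine abs_le_of_sq_le_sq' (a := y) (b := 2 * S) ?_ (by linarith) |>.2
    nlinarith [mul_nonneg (sq_nonneg y) (sub_nonneg.2 hδ1), sq_nonneg y]
  have hp1 : (1 - δ) * y ^ 2 ≤ (1 - δ / 2) * S ^ 2 := by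
    have e1 := mul_le_mul_of_nonneg_left hx (show 0 ≤ 1 - δ / 2 by linarith)
    have e2 : 0 ≤ y ^ 2 * (δ / 4 + δ ^ 2 / 8) := by positivity
    linarith
  have hp2 : g * y ≤ g * (2 * S) := mul_le_mul_of_nonneg_left hyS hg.le
  have hp2' : g * g ≤ g * S := mul_le_mul_of_nonneg_left (hg1.trans hS1) hg.le
  have hp3 : 6 ≤ S * c := by rwa [div_le_iff₀ hc] at hSc
  have hp4 : 6 * g ≤ S * δ := by
    have e1 := mul_le_mul_of_nonneg_right hp3 hg.le
    have e2 := mul_le_mul_of_nonneg_left hcg (show 0 ≤ S by linarith)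
    linarith
  have hp5 := mul_le_mul_of_nonneg_left hp4 (show 0 ≤ S by linarith)
  linarith

/-- A deterministic sequence lemma: if `v n ≤ ρ n * v (n-1) + γ n * √(v (n-1)) + γ n ^ 2`
with `n (1 - ρ n) → ∞`, and there is `α > 1/2` with `n ^ α * γ n → 0` and
`liminf (1 - ρ n) / (n ^ α * γ n) > 0`, then `(n ^ (2α) * v n)` is bounded and `∑ v n < ∞`. -/
theorem stmt_15 (v γ ρ : ℕ → ℝ)
    (hv : ∀ n, 0 ≤ v n) (hγ : ∀ n, 1 ≤ n → 0 < γ n) (hρ : ∀ n, 1 ≤ n → 0 ≤ ρ n)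
    (hrec : ∀ n, 1 ≤ n → v n ≤ ρ n * v (n - 1) + γ n * Real.sqrt (v (n - 1)) + γ n ^ 2)
    (hnρ : Tendsto (fun n : ℕ => (n : ℝ) * (1 - ρ n)) atTop atTop)
    (α : ℝ) (hα : 1 / 2 < α)
    (hγα : Tendsto (fun n : ℕ => (n : ℝ) ^ α * γ n) atTop (nhds 0))
    (hliminf : ∃ c > 0, ∀ᶠ n : ℕ in atTop, c ≤ (1 - ρ n) / ((n : ℝ) ^ α * γ n)) :
    (∃ B : ℝ, ∀ n : ℕ, 1 ≤ n → (n : ℝ) ^ (2 * α) * v n ≤ B) ∧ Summable v := by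
  obtain ⟨c, hc, hcl⟩ := hliminf
  have hg1 : ∀ᶠ n : ℕ in atTop, (n : ℝ) ^ α * γ n < 1 := hγα.eventually_lt_const one_pos
  have hd := hnρ.eventually_ge_atTop (8 * α)
  obtain ⟨N, hN⟩ := eventually_atTop.1 (hcl.and (hg1.and hd))
  have hbd : ∃ B : ℝ, ∀ n : ℕ, 1 ≤ n → (n : ℝ) ^ (2 * α) * v n ≤ B := by
    set w : ℕ → ℝ := fun n => (n : ℝ) ^ (2 * α) * v n with hw
    have hw0 : ∀ n, 0 ≤ w n := fun n => mul_nonneg (Real.rpow_nonneg (Nat.cast_nonneg n) _) (hv n)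
    obtain ⟨S, hS1, hSc, hSw⟩ : ∃ S : ℝ, 1 ≤ S ∧ 6 / c ≤ S ∧ w (N + 1) ≤ S ^ 2 := by
      refine ⟨1 + 6 / c + w (N + 1), ?_, ?_, ?_⟩
      · have := hw0 (N + 1); have : 0 < 6 / c := by positivity
        linarith
      · have := hw0 (N + 1); linarith
      · have h1 := hw0 (N + 1); have h2 : 0 < 6 / c := by positivity
        nlinarith [mul_nonneg h2.le h1]
    have key : ∀ k, w (N + 1 + k) ≤ S ^ 2 := by
      intro k
      induction k with
      | zero => simpa using hSw
      | succ k ih =>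
        have hn1 : 1 ≤ N + 1 + k + 1 := by omega
        obtain ⟨h1, h2, h3⟩ := hN (N + 1 + k + 1) (by omega)
        have hr := hrec _ hn1
        have hgp := hγ _ hn1
        have hrp := hρ _ hn1
        have hm : N + 1 + k + 1 - 1 = N + 1 + k := by omega
        rw [hm] at hr
        have hm1 : 1 ≤ N + 1 + k := by omega
        show w (N + 1 + k + 1) ≤ S ^ 2
        simp only [hw] at ih ⊢
        generalize N + 1 + k = m at *
        have hcast : ((m + 1 : ℕ) : ℝ) = (m : ℝ) + 1 := by push_cast; ring
        have hmp : (1 : ℝ) ≤ m := by exact_mod_cast hm1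
        rw [hcast] at h1 h2 h3 ⊢
        set n : ℝ := (m : ℝ) + 1 with hn
        have hnp : 0 < n := by linarith
        have hap : 0 < n ^ α := Real.rpow_pos_of_pos hnp _
        set a := n ^ α with ha
        have hs : n ^ (2 * α) = a ^ 2 := by
          rw [ha, mul_comm, Real.rpow_mul hnp.le]; norm_num
        obtain ⟨δ, hδ⟩ : ∃ δ, δ = 1 - ρ (m + 1) := ⟨_, rfl⟩
        have hρe : ρ (m + 1) = 1 - δ := by linarith
        rw [hρe] at hr hrp h1 h3
        obtain ⟨g, hg⟩ : ∃ g, g = a * γ (m + 1) := ⟨_, rfl⟩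
        rw [← hg] at h1 h2
        have hgpos : 0 < g := by rw [hg]; positivity
        rw [le_div_iff₀ hgpos] at h1
        have hcg : c * g ≤ δ := by linarith
        have hδ0 : 0 < δ := lt_of_lt_of_le (mul_pos hc hgpos) hcg
        have hδ1 : δ ≤ 1 := by linarith
        have h3' : 8 * α ≤ n * δ := by linarith
        have hB : 1 - δ / 4 ≤ (1 + -(1 / n)) ^ (2 * α) := by
          have hb := one_add_mul_self_le_rpow_one_add (s := -(1 / n)) (p := 2 * α)
            (by rw [neg_le_neg_iff, div_le_one hnp]; linarith) (by linarith)
          have : 2 * α * (1 / n) ≤ δ / 4 := by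
            rw [mul_one_div, div_le_iff₀ hnp]; linarith
          linarith
        have ht : a ^ 2 * (1 - δ / 4) ≤ (m : ℝ) ^ (2 * α) := by
          have e : (m : ℝ) = n * (1 + -(1 / n)) := by field_simp; linarith
          rw [e, Real.mul_rpow hnp.le (by
            have : 1 / n ≤ 1 := by rw [div_le_one hnp]; linarith
            linarith), hs]
          gcongr
        set q := Real.sqrt (v m) with hq
        have hq0 : 0 ≤ q := Real.sqrt_nonneg _
        have hqv : v m = q ^ 2 := (Real.sq_sqrt (hv m)).symm
        have hx : (a * q) ^ 2 * (1 - δ / 4) ≤ S ^ 2 := by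
          have := mul_le_mul_of_nonneg_right ht (hv m)
          rw [hqv] at this ih
          nlinarith
        rw [hqv] at hr
        have hr2 : n ^ (2 * α) * v (m + 1) ≤ (1 - δ) * (a * q) ^ 2 + g * (a * q) + g ^ 2 := by
          rw [hs, hg]
          have := mul_le_mul_of_nonneg_left hr (sq_nonneg a)
          linarith
        have hy0 : 0 ≤ a * q := by positivity
        generalize a * q = y at *
        exact hr2.trans (step_aux hc hS1 hSc hgpos h2.le hcg hδ0 hδ1 hy0 hx)
    refine ⟨S ^ 2 + ∑ i ∈ Finset.range (N + 1), w i, fun n _ => ?_⟩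
    by_cases h : n < N + 1
    · have := Finset.single_le_sum (fun i _ => hw0 i) (Finset.mem_range.2 h)
      have h' : w n ≤ S ^ 2 + ∑ i ∈ Finset.range (N + 1), w i := by nlinarith [sq_nonneg S]
      exact h'
    · obtain ⟨k, rfl⟩ := Nat.exists_eq_add_of_le (not_lt.1 h)
      have h1 := key k
      have h2 := Finset.sum_nonneg (fun i (_ : i ∈ Finset.range (N + 1)) => hw0 i)
      have h' : w (N + 1 + k) ≤ S ^ 2 + ∑ i ∈ Finset.range (N + 1), w i := by linarith
      exact h'
  refine ⟨hbd, ?_⟩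
  obtain ⟨B, hB⟩ := hbd
  have hs : Summable (fun n : ℕ => B * (1 / (n : ℝ) ^ (2 * α))) :=
    (Real.summable_one_div_nat_rpow.2 (by linarith)).mul_left B
  rw [← summable_nat_add_iff 1] at hs ⊢
  refine Summable.of_nonneg_of_le (fun n => hv _) (fun n => ?_) hs
  have hp : (0 : ℝ) < ((n + 1 : ℕ) : ℝ) ^ (2 * α) := Real.rpow_pos_of_pos (by positivity) _
  rw [mul_one_div, le_div_iff₀ hp]
  have := hB (n + 1) (by omega)
  linarith
end

section
/- Let F be a set-valued map from ℝ^d to subsets of ℝ^d satisfying Condition 1, let Λ ⊆ ℝ^d be a compact set, and let V : ℝ^d → ℝ be a Lyapunov function for Λ such that V(Λ) has empty interior in ℝ. Then for every bounded perturbed solution y to the differential inclusion dx/dt ∈ F(x), one has ⋂_{t≥0} closure(y([t,∞))) ⊆ Λ. -/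
open MeasureTheory Metric Filter

/-- The `δ`-enlargement `F^δ` of a set-valued map `F` on `ℝ^d`. -/
def Fdelta {d : ℕ} (F : EuclideanSpace ℝ (Fin d) → Set (EuclideanSpace ℝ (Fin d)))
    (δ : ℝ) (θ : EuclideanSpace ℝ (Fin d)) : Set (EuclideanSpace ℝ (Fin d)) :=
  {z | ∃ θ', ‖θ - θ'‖ < δ ∧ infDist z (F θ') < δ}

/-- A solution of the differential inclusion `dx/dt ∈ F(x)`: an absolutely continuous
`x : ℝ → ℝ^d` (encoded via a locally integrable a.e. derivative `x'` satisfying the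
fundamental theorem of calculus) with `x'(t) ∈ F(x(t))` for a.e. `t`. -/
def IsDISolution {d : ℕ} (F : EuclideanSpace ℝ (Fin d) → Set (EuclideanSpace ℝ (Fin d)))
    (x : ℝ → EuclideanSpace ℝ (Fin d)) : Prop :=
  ∃ x' : ℝ → EuclideanSpace ℝ (Fin d),
    (∀ a b : ℝ, IntervalIntegrable x' volume a b) ∧
    (∀ a b : ℝ, x b - x a = ∫ t in a..b, x' t) ∧
    ∀ᵐ t : ℝ, x' t ∈ F (x t)

/-- A perturbed solution of `dx/dt ∈ F(x)` on `[0,∞)`: an absolutely continuous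
`y : ℝ → ℝ^d` (encoded via an a.e. derivative `y'` on `[0,∞)`) for which there exist a
locally integrable `U` whose sliding integrals `∫_t^{t+v} U`, `0 ≤ v ≤ T`, vanish uniformly
as `t → ∞`, and `δ : [0,∞) → [0,∞)` with `δ(t) → 0`, such that
`y'(t) - U(t) ∈ F^{δ(t)}(y(t))` for a.e. `t > 0`. -/
def IsPerturbedSolution {d : ℕ} (F : EuclideanSpace ℝ (Fin d) → Set (EuclideanSpace ℝ (Fin d)))
    (y : ℝ → EuclideanSpace ℝ (Fin d)) : Prop :=
  ∃ y' U : ℝ → EuclideanSpace ℝ (Fin d), ∃ δ : ℝ → ℝ,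
    (∀ a b : ℝ, 0 ≤ a → IntervalIntegrable y' volume a b) ∧
    (∀ a b : ℝ, 0 ≤ a → a ≤ b → y b - y a = ∫ t in a..b, y' t) ∧
    (∀ a b : ℝ, 0 ≤ a → IntervalIntegrable U volume a b) ∧
    (∀ T > (0 : ℝ), ∀ ε > (0 : ℝ), ∀ᶠ t : ℝ in atTop,
      ∀ v ∈ Set.Icc (0 : ℝ) T, ‖∫ s in t..(t + v), U s‖ ≤ ε) ∧
    (∀ t, 0 ≤ δ t) ∧ Tendsto δ atTop (nhds 0) ∧
    ∀ᵐ t : ℝ ∂(volume.restrict (Set.Ioi (0 : ℝ))), y' t - U t ∈ Fdelta F (δ t) (y t)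

section Aux
open Set Topology

/-- Upper semicontinuity of `F`. -/
lemma usc_aux {d : ℕ}
    (F : EuclideanSpace ℝ (Fin d) → Set (EuclideanSpace ℝ (Fin d)))
    (hFgraph : IsClosed {p : EuclideanSpace ℝ (Fin d) × EuclideanSpace ℝ (Fin d) |
        p.2 ∈ F p.1})
    (c : ℝ) (hc : 0 < c) (hFbdd : ∀ θ, ∀ z ∈ F θ, ‖z‖ < c * (1 + ‖θ‖))
    (θ : EuclideanSpace ℝ (Fin d)) (ε : ℝ) (hε : 0 < ε) :
    ∃ η > 0, ∀ θ', ‖θ' - θ‖ < η → F θ' ⊆ thickening ε (F θ) := by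
  by_contra! H
  have H' : ∀ n : ℕ, ∃ θ' z, ‖θ' - θ‖ < 1 / ((n : ℝ) + 1) ∧ z ∈ F θ' ∧ z ∉ thickening ε (F θ) := by
    intro n
    obtain ⟨θ', h1, h2⟩ := H (1 / ((n : ℝ) + 1)) (by positivity)
    obtain ⟨z, hz, hz'⟩ := not_subset.1 h2
    exact ⟨θ', z, h1, hz, hz'⟩
  choose a z h1 h2 h3 using H'
  have ha : Tendsto a atTop (𝓝 θ) := by
    rw [tendsto_iff_norm_sub_tendsto_zero]
    exact squeeze_zero (fun _ => norm_nonneg _) (fun n => (h1 n).le)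
      tendsto_one_div_add_atTop_nhds_zero_nat
  have hz : ∀ n, z n ∈ closedBall (0 : EuclideanSpace ℝ (Fin d)) (c * (1 + (‖θ‖ + 1))) := by
    intro n
    rw [mem_closedBall_zero_iff]
    refine (hFbdd _ _ (h2 n)).le.trans ?_
    have : ‖a n‖ ≤ ‖θ‖ + 1 := by
      have e1 : ‖a n‖ ≤ ‖θ‖ + ‖a n - θ‖ := norm_le_norm_add_norm_sub' _ _
      have e2 : 1 / ((n : ℝ) + 1) ≤ 1 := by
        rw [div_le_one (by positivity)]
        have : (0 : ℝ) ≤ n := Nat.cast_nonneg n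
        linarith
      linarith [h1 n]
    gcongr
  obtain ⟨w, -, φ, hφ, hw⟩ := (isCompact_closedBall _ _).tendsto_subseq hz
  have hmem : w ∈ F θ :=
    hFgraph.mem_of_tendsto (((ha.comp hφ.tendsto_atTop).prodMk_nhds hw))
      (Eventually.of_forall fun n => h2 (φ n))
  have : w ∈ thickening ε (F θ) := self_subset_thickening hε _ hmem
  have h4 := hw.eventually (isOpen_thickening.mem_nhds this)
  obtain ⟨n, hn⟩ := h4.exists
  exact h3 (φ n) hn

/-- FTC for Lipschitz functions with values in `ℝ^d`. -/
lemma lipschitz_ftc {d : ℕ} (x : ℝ → EuclideanSpace ℝ (Fin d)) (K : NNReal)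
    (hx : LipschitzWith K x) :
    (∀ a b : ℝ, IntervalIntegrable (deriv x) volume a b) ∧
    (∀ a b : ℝ, x b - x a = ∫ t in a..b, deriv x t) := by
  have hI : ∀ a b : ℝ, IntervalIntegrable (deriv x) volume a b := by
    intro a b
    refine (intervalIntegrable_const (c := (K : ℝ))).mono_fun
      (stronglyMeasurable_deriv x).aestronglyMeasurable ?_
    refine Eventually.of_forall fun t => ?_
    simpa using norm_deriv_le_of_lipschitz (x₀ := t) hx
  refine ⟨hI, fun a b => ?_⟩
  ext i
  let P : EuclideanSpace ℝ (Fin d) →L[ℝ] ℝ := EuclideanSpace.proj i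
  have h1 : P (∫ t in a..b, deriv x t) = ∫ t in a..b, P (deriv x t) :=
    (P.intervalIntegral_comp_comm (hI a b)).symm
  have hLip : LipschitzWith (‖P‖₊ * K) (fun t => P (x t)) := P.lipschitz.comp hx
  have h2 := ((hLip.lipschitzOnWith (s := uIcc a b)).absolutelyContinuousOnInterval).integral_deriv_eq_sub
  have h3 : ∫ t in a..b, P (deriv x t) = ∫ t in a..b, deriv (fun t => P (x t)) t := by
    apply intervalIntegral.integral_congr_ae
    filter_upwards [hx.ae_differentiableAt_real] with t ht _
    exact ((P.hasFDerivAt.comp_hasDerivAt t ht.hasDerivAt).deriv).symm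
  change P (x b - x a) = P (∫ t in a..b, deriv x t)
  rw [h1, h3, h2, map_sub]

/-- The limit theorem along ultrafilters. -/
lemma limit_solution {d : ℕ}
    (F : EuclideanSpace ℝ (Fin d) → Set (EuclideanSpace ℝ (Fin d)))
    (hFgraph : IsClosed {p : EuclideanSpace ℝ (Fin d) × EuclideanSpace ℝ (Fin d) |
        p.2 ∈ F p.1})
    (hFne : ∀ θ, (F θ).Nonempty) (hFcpt : ∀ θ, IsCompact (F θ))
    (hFconv : ∀ θ, Convex ℝ (F θ))
    (c : ℝ) (hc : 0 < c) (hFbdd : ∀ θ, ∀ z ∈ F θ, ‖z‖ < c * (1 + ‖θ‖))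
    (y g : ℝ → EuclideanSpace ℝ (Fin d)) (δ : ℝ → ℝ)
    (M : ℝ) (hM : ∀ t : ℝ, 0 ≤ t → ‖y t‖ ≤ M)
    (hg : ∀ a b : ℝ, IntervalIntegrable g volume a b)
    (hδ : Tendsto δ atTop (𝓝 0))
    (hgF : ∀ᵐ r : ℝ, 0 < r → g r ∈ Fdelta F (δ r) (y r))
    (hyg : ∀ R > (0 : ℝ), ∀ ε > (0 : ℝ), ∀ᶠ t : ℝ in atTop, ∀ a ∈ Icc (-R) R, ∀ b ∈ Icc (-R) R,
      ‖y (t + b) - y (t + a) - ∫ s in (t + a)..(t + b), g s‖ ≤ ε)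
    {ι : Type*} (𝒰 : Ultrafilter ι) (u : ι → ℝ) (hu : Tendsto u 𝒰 atTop) :
    ∃ x : ℝ → EuclideanSpace ℝ (Fin d), IsDISolution F x ∧
      ∀ (s : ι → ℝ) (σ : ℝ), Tendsto s 𝒰 (𝓝 σ) →
        Tendsto (fun i => y (u i + s i)) 𝒰 (𝓝 (x σ)) := by
  have hM0 : 0 ≤ M := (norm_nonneg _).trans (hM 0 le_rfl)
  -- the uniform bound on `g`
  obtain ⟨K, hK0, hK⟩ : ∃ K : ℝ, 0 ≤ K ∧ ∀ᶠ T : ℝ in atTop, ∀ᵐ r : ℝ, T < r → ‖g r‖ ≤ K := by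
    refine ⟨c * (1 + (M + 1)) + 1, by positivity, ?_⟩
    have h1 : ∀ᶠ r in atTop, δ r < 1 := hδ.eventually (gt_mem_nhds one_pos)
    obtain ⟨T0, hT0⟩ := eventually_atTop.1 h1
    filter_upwards [eventually_ge_atTop T0, eventually_ge_atTop 0] with T hT hT'
    filter_upwards [hgF] with r hr hTr
    obtain ⟨θ', e1, e2⟩ := hr (by linarith)
    have e3 := hT0 r (by linarith)
    obtain ⟨z, hz, hz'⟩ := (infDist_lt_iff (hFne θ')).1 (e2.trans e3)
    have e4 := hFbdd _ _ hz
    have e5 : ‖θ'‖ ≤ M + 1 := by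
      have := norm_le_norm_add_norm_sub (y r) θ'
      have := hM r (by linarith)
      linarith
    have e6 : ‖g r‖ ≤ ‖z‖ + ‖g r - z‖ := norm_le_norm_add_norm_sub' _ _
    rw [dist_eq_norm] at hz'
    have e7 : c * (1 + ‖θ'‖) ≤ c * (1 + (M + 1)) := by gcongr
    linarith
  -- asymptotic Lipschitz property
  have hlip : ∀ R > (0 : ℝ), ∀ ε > (0 : ℝ), ∀ᶠ t : ℝ in atTop, ∀ a ∈ Icc (-R) R,
      ∀ b ∈ Icc (-R) R, ‖y (t + b) - y (t + a)‖ ≤ K * |b - a| + ε := by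
    intro R hR ε hε
    obtain ⟨T0, hT0⟩ := hK.exists
    filter_upwards [hyg R hR ε hε, eventually_ge_atTop (T0 + R)] with t ht htT a ha b hb
    have e1 : ‖∫ s in (t + a)..(t + b), g s‖ ≤ K * |(t + b) - (t + a)| := by
      apply intervalIntegral.norm_integral_le_of_norm_le_const_ae
      filter_upwards [hT0] with r hr hr'
      apply hr
      rw [uIoc, mem_Ioc] at hr'
      have : T0 ≤ min (t + a) (t + b) := le_min (by linarith [ha.1]) (by linarith [hb.1])
      linarith [hr'.1]
    rw [add_sub_add_left_eq_sub] at e1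
    have e2 := ht a ha b hb
    have e3 := norm_le_norm_add_norm_sub' (y (t + b) - y (t + a)) (∫ s in (t + a)..(t + b), g s)
    linarith
  -- pointwise limits
  have hlim : ∀ s : ℝ, ∃ p, Tendsto (fun i => y (u i + s)) 𝒰 (𝓝 p) := by
    intro s
    have h1 : ∀ᶠ i in (𝒰 : Filter ι), y (u i + s) ∈ closedBall (0 : EuclideanSpace ℝ (Fin d)) M := by
      filter_upwards [hu.eventually (eventually_ge_atTop (-s))] with i hi
      rw [mem_closedBall_zero_iff]
      exact hM _ (by linarith)
    obtain ⟨p, -, hp⟩ := (isCompact_closedBall (0 : EuclideanSpace ℝ (Fin d)) M).ultrafilter_le_nhds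
      (𝒰.map (fun i => y (u i + s))) (le_principal_iff.2 h1)
    exact ⟨p, hp⟩
  choose x hx using hlim
  have hmove : ∀ (s : ι → ℝ) (σ : ℝ), Tendsto s 𝒰 (𝓝 σ) →
        Tendsto (fun i => y (u i + s i)) 𝒰 (𝓝 (x σ)) := by
    intro s σ hs
    have h0 : Tendsto (fun i => y (u i + s i) - y (u i + σ)) 𝒰 (𝓝 0) := by
      rw [Metric.tendsto_nhds]
      intro ε hε
      have hR : 0 < |σ| + 1 := by positivity
      have h1 := hu.eventually (hlip (|σ| + 1) hR (ε / 2) (by positivity))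
      have h2 : ∀ᶠ i in (𝒰 : Filter ι), |s i - σ| < min 1 (ε / (2 * (K + 1))) := by
        have := (Metric.tendsto_nhds.1 hs) (min 1 (ε / (2 * (K + 1)))) (by positivity)
        simpa [Real.dist_eq] using this
      filter_upwards [h1, h2] with i h1 h2
      have h3 := lt_of_lt_of_le h2 (min_le_left _ _)
      have h4 := lt_of_lt_of_le h2 (min_le_right _ _)
      have h5 := h1 σ (abs_le.1 (by linarith)) (s i) (abs_le.1 (by
        have : |s i| ≤ |s i - σ| + |σ| := by simpa using abs_add_le (s i - σ) σ
        linarith))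
      rw [dist_zero_right]
      have h6 : (K + 1) * |s i - σ| < ε / 2 := by
        rw [lt_div_iff₀ (by positivity)] at h4
        linarith
      nlinarith [abs_nonneg (s i - σ)]
    simpa using h0.add (hx σ)
  have hxlip : LipschitzWith ⟨K, hK0⟩ x := by
    apply LipschitzWith.of_dist_le_mul
    intro b a
    rw [dist_eq_norm, Real.dist_eq]
    refine le_of_forall_pos_le_add fun ε hε => ?_
    have h1 := hu.eventually (hlip (max |a| |b| + 1) (by positivity) ε hε)
    refine le_of_tendsto ((hx b).sub (hx a)).norm ?_
    filter_upwards [h1] with i hi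
    exact hi a (abs_le.1 (by linarith [le_max_left |a| |b|])) b
      (abs_le.1 (by linarith [le_max_right |a| |b|]))
  refine ⟨x, ⟨deriv x, (lipschitz_ftc x _ hxlip).1, (lipschitz_ftc x _ hxlip).2, ?_⟩, hmove⟩
  filter_upwards [hxlip.ae_differentiableAt_real] with t ht
  suffices h : ∀ ε > 0, deriv x t ∈ cthickening ε (F (x t)) by
    rw [← (hFcpt (x t)).isClosed.closure_eq, closure_eq_iInter_cthickening]
    simpa using h
  intro ε hε
  obtain ⟨η, hη, husc⟩ := usc_aux F hFgraph c hc hFbdd (x t) (ε / 2) (by positivity)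
  have hslope := ht.hasDerivAt.tendsto_slope_zero_right
  refine isClosed_cthickening.mem_of_tendsto hslope ?_
  have hsmall : ∀ᶠ h : ℝ in 𝓝[>] 0, h < η / (8 * (K + 1)) :=
    mem_nhdsWithin_of_mem_nhds (gt_mem_nhds (by positivity))
  filter_upwards [hsmall, self_mem_nhdsWithin] with h hh hpos
  have hpos : 0 < h := hpos
  have hKh : K * h < η / 8 := by
    rw [lt_div_iff₀ (by positivity)] at hh
    nlinarith
  -- the averages converge to the slope
  have hR : 0 < |t| + h := by positivity
  have htR : t ∈ Icc (-(|t| + h)) (|t| + h) := abs_le.1 (by linarith)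
  have hthR : t + h ∈ Icc (-(|t| + h)) (|t| + h) :=
    abs_le.1 ((abs_add_le _ _).trans (by rw [abs_of_pos hpos]))
  have hav : Tendsto (fun i => h⁻¹ • ∫ s in (u i + t)..(u i + (t + h)), g s) 𝒰
      (𝓝 (h⁻¹ • (x (t + h) - x t))) := by
    apply Tendsto.const_smul
    have h0 : Tendsto (fun i => y (u i + (t + h)) - y (u i + t)
        - ∫ s in (u i + t)..(u i + (t + h)), g s) 𝒰 (𝓝 0) := by
      rw [Metric.tendsto_nhds]
      intro e he
      filter_upwards [hu.eventually (hyg (|t| + h) hR (e / 2) (by positivity))] with i hi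
      rw [dist_zero_right]
      exact (hi t htR (t + h) hthR).trans_lt (by linarith)
    simpa using ((hx (t + h)).sub (hx t)).sub h0
  refine isClosed_cthickening.mem_of_tendsto hav ?_
  have hδ' : ∀ᶠ r in atTop, δ r < min (η / 2) (ε / 2) := hδ.eventually (gt_mem_nhds (by positivity))
  obtain ⟨T0, hT0⟩ := eventually_atTop.1 hδ'
  have hnear : ∀ᶠ i in (𝒰 : Filter ι), ‖y (u i + t) - x t‖ < η / 8 := by
    have := (Metric.tendsto_nhds.1 (hx t)) (η / 8) (by positivity)
    simpa [dist_eq_norm] using this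
  filter_upwards [hnear, hu.eventually (hlip (|t| + h) hR (η / 8) (by positivity)),
    hu.eventually (eventually_ge_atTop (T0 - t)), hu.eventually (eventually_ge_atTop (-t))]
    with i hi1 hi2 hi3 hi4
  have hlt : u i + t < u i + (t + h) := by linarith
  have hmem : (⨍ s in Ioc (u i + t) (u i + (t + h)), g s) ∈ cthickening ε (F (x t)) := by
    refine ((hFconv (x t)).cthickening ε).set_average_mem isClosed_cthickening ?_ ?_ ?_ ?_
    · simp [hpos]
    · simp
    · rw [ae_restrict_iff' measurableSet_Ioc]
      filter_upwards [hgF] with r hr hr'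
      have hr0 : 0 < r := by linarith [hr'.1]
      obtain ⟨θ', e1, e2⟩ := hr hr0
      have e3 := hT0 r (by linarith [hr'.1])
      have e4 := e3.trans_le (min_le_left _ _)
      have e5 := e3.trans_le (min_le_right _ _)
      obtain ⟨z, hz, hz'⟩ := (infDist_lt_iff (hFne θ')).1 (e2.trans e5)
      have e6 : ‖y r - y (u i + t)‖ ≤ η / 4 := by
        have hrR : r - u i ∈ Icc (-(|t| + h)) (|t| + h) :=
          ⟨by linarith [htR.1, hr'.1], by linarith [hthR.2, hr'.2]⟩
        have := hi2 t htR (r - u i) hrR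
        rw [add_sub_cancel] at this
        have e7 : |r - u i - t| ≤ h := abs_le.2 ⟨by linarith [hr'.1], by linarith [hr'.2]⟩
        have e8 : K * |r - u i - t| ≤ K * h := by gcongr
        linarith
      have e9 : ‖θ' - x t‖ < η := by
        have h1 : θ' - x t = -(y r - θ') + (y r - y (u i + t)) + (y (u i + t) - x t) := by abel
        rw [h1]
        refine (norm_add₃_le).trans_lt ?_
        rw [norm_neg]
        linarith
      obtain ⟨w, hw, hw'⟩ := mem_thickening_iff.1 (husc θ' e9 hz)
      refine mem_cthickening_of_dist_le _ w _ _ hw ?_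
      linarith [dist_triangle (g r) z w]
    · exact (intervalIntegrable_iff_integrableOn_Ioc_of_le hlt.le).1 (hg _ _)
  have heq : (⨍ s in Ioc (u i + t) (u i + (t + h)), g s)
      = h⁻¹ • ∫ s in (u i + t)..(u i + (t + h)), g s := by
    rw [← uIoc_of_le hlt.le, interval_average_eq]
    congr 2
    ring
  rwa [heq] at hmem

/-- A continuous function passing from below `v` to above `v'` has a last crossing of `v`. -/
lemma last_crossing (f : ℝ → ℝ) (a b v : ℝ) (hab : a ≤ b) (hf : ContinuousOn f (Icc a b))
    (ha : f a < v) (hb : v < f b) :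
    ∃ s ∈ Icc a b, f s = v ∧ ∀ t ∈ Icc s b, v ≤ f t := by
  have hcl : IsCompact (Icc a b ∩ f ⁻¹' {v}) :=
    (isCompact_Icc).of_isClosed_subset (hf.preimage_isClosed_of_isClosed isClosed_Icc
      isClosed_singleton) inter_subset_left
  obtain ⟨r, hr, hrv⟩ := intermediate_value_Icc hab hf ⟨ha.le, hb.le⟩
  obtain ⟨s, hs, hmax⟩ := hcl.exists_isGreatest ⟨r, hr, hrv⟩
  refine ⟨s, hs.1, hs.2, fun t ht => ?_⟩
  by_contra! hlt
  have hsub : Icc t b ⊆ Icc a b := Icc_subset_Icc_left (hs.1.1.trans ht.1)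
  obtain ⟨q, hq, hqv⟩ := intermediate_value_Icc ht.2 (hf.mono hsub) ⟨hlt.le, hb.le⟩
  have h1 : q ≤ s := hmax ⟨hsub hq, hqv⟩
  have h2 : t = s := le_antisymm (hq.1.trans h1) ht.1
  have h3 : f s = v := hs.2
  rw [h2, h3] at hlt
  exact lt_irrefl _ hlt

/-- The main argument, from the limit theorem. -/
lemma main_aux {E : Type*} [NormedAddCommGroup E] [ProperSpace E] (S : (ℝ → E) → Prop)
    (Λ : Set E) (V : E → ℝ) (hVcont : Continuous V)
    (hLyap : ∀ x : ℝ → E, S x →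
      ∀ t : ℝ, 0 < t → V (x t) ≤ V (x 0) ∧ (x 0 ∉ Λ → V (x t) < V (x 0)))
    (hVint : interior (V '' Λ) = ∅)
    (y : ℝ → E) (hyc : ContinuousOn y (Ici 0))
    (M : ℝ) (hM : ∀ t : ℝ, 0 ≤ t → ‖y t‖ ≤ M)
    (hlim : ∀ {ι : Type} (𝒰 : Ultrafilter ι) (u : ι → ℝ), Tendsto u 𝒰 atTop →
      ∃ x : ℝ → E, S x ∧
      ∀ (s : ι → ℝ) (σ : ℝ), Tendsto s 𝒰 (𝓝 σ) →
        Tendsto (fun i => y (u i + s i)) 𝒰 (𝓝 (x σ))) :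
    (⋂ (t : ℝ) (_ : 0 ≤ t), closure (y '' Set.Ici t)) ⊆ Λ := by
  have hVyc : ContinuousOn (fun t => V (y t)) (Ici 0) := hVcont.comp_continuousOn hyc
  have hbd : ∃ B, ∀ t, 0 ≤ t → |V (y t)| ≤ B := by
    obtain ⟨B, hB⟩ := (isCompact_closedBall (0 : E) M).exists_bound_of_continuousOn
      hVcont.continuousOn
    exact ⟨B, fun t ht => hB _ (mem_closedBall_zero_iff.2 (hM t ht))⟩
  obtain ⟨B, hB⟩ := hbd
  have hconv : ∃ ℓ, Tendsto (fun t => V (y t)) atTop (𝓝 ℓ) := by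
    refine tendsto_of_no_upcrossings (interior_eq_empty_iff_dense_compl.1 hVint) ?_ ?_ ?_
    · rintro v hv v' - hvv' ⟨hlow, hhigh⟩
      have hcross : ∀ n : ℕ, ∃ s w : ℝ, (n : ℝ) ≤ s ∧ s ≤ w ∧ V (y s) = v ∧ v' ≤ V (y w) ∧
          ∀ t ∈ Icc s w, v ≤ V (y t) := by
        intro n
        obtain ⟨a, hna, ha⟩ := frequently_atTop.1 hlow n
        obtain ⟨b, hab, hb⟩ := frequently_atTop.1 hhigh a
        have hn : (0 : ℝ) ≤ n := Nat.cast_nonneg n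
        obtain ⟨s, hs, hsv, hst⟩ := last_crossing (fun t => V (y t)) a b v hab
          (hVyc.mono fun t ht => (hn.trans hna).trans ht.1) ha (hvv'.trans hb)
        exact ⟨s, b, hna.trans hs.1, hs.2, hsv, hb.le, hst⟩
      choose s w hns hsw hsv hwv hst using hcross
      let 𝒰 : Ultrafilter ℕ := hyperfilter ℕ
      have h𝒰 : (𝒰 : Filter ℕ) ≤ atTop := Nat.hyperfilter_le_atTop
      have hs : Tendsto s 𝒰 atTop :=
        (tendsto_atTop_mono hns tendsto_natCast_atTop_atTop).mono_left h𝒰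
      obtain ⟨x, hxS, hx⟩ := hlim 𝒰 s hs
      have hx0 : V (x 0) = v := by
        have h1 := hVcont.continuousAt.tendsto.comp (hx (fun _ => 0) 0 tendsto_const_nhds)
        refine tendsto_nhds_unique h1 ?_
        simp [Function.comp_def, hsv]
      have hx0Λ : x 0 ∉ Λ := fun h => hv ⟨x 0, h, hx0⟩
      by_cases hc : ∀ᶠ n in (𝒰 : Filter ℕ), w n - s n ≤ 1
      · have hmem : ∀ᶠ n in (𝒰 : Filter ℕ), w n - s n ∈ Icc (0 : ℝ) 1 := by
          filter_upwards [hc] with n hn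
          exact ⟨by linarith [hsw n], hn⟩
        obtain ⟨τ, hτ, hτ'⟩ := (isCompact_Icc (a := (0 : ℝ)) (b := 1)).ultrafilter_le_nhds
          (𝒰.map (fun n => w n - s n)) (le_principal_iff.2 hmem)
        have h1 := hVcont.continuousAt.tendsto.comp (hx (fun n => w n - s n) τ hτ')
        have h2 : v' ≤ V (x τ) := by
          refine ge_of_tendsto h1 (Eventually.of_forall fun n => ?_)
          simpa using hwv n
        have h3 : V (x τ) ≤ V (x 0) := by
          rcases hτ.1.eq_or_lt with h | h
          · rw [← h]
          · exact (hLyap x hxS τ h).1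
        linarith
      · rw [← Ultrafilter.eventually_not] at hc
        have h1 := hVcont.continuousAt.tendsto.comp (hx (fun _ => 1) 1 tendsto_const_nhds)
        have h2 : v ≤ V (x 1) := by
          refine ge_of_tendsto h1 ?_
          filter_upwards [hc] with n hn
          exact hst n _ ⟨by linarith, by linarith⟩
        have h3 := (hLyap x hxS 1 one_pos).2 hx0Λ
        linarith
    · exact ⟨B, eventually_map.2 ((eventually_ge_atTop 0).mono fun t ht => (abs_le.1 (hB t ht)).2)⟩
    · exact ⟨-B, eventually_map.2 ((eventually_ge_atTop 0).mono fun t ht => (abs_le.1 (hB t ht)).1)⟩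
  obtain ⟨ℓ, hℓ⟩ := hconv
  intro p hp
  have hcl : MapClusterPt p atTop y := by
    rw [mapClusterPt_iff_frequently]
    intro N hN
    rw [frequently_atTop]
    intro a
    have h1 := mem_iInter₂.1 hp (max a 0) (le_max_right _ _)
    obtain ⟨z, hz, t, ht, rfl⟩ := mem_closure_iff_nhds.1 h1 N hN
    exact ⟨t, (le_max_left _ _).trans ht, hz⟩
  obtain ⟨𝒰, h𝒰, hyp⟩ := mapClusterPt_iff_ultrafilter.1 hcl
  obtain ⟨x, hxS, hx⟩ := hlim 𝒰 id h𝒰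
  have hx0 : x 0 = p := by
    refine tendsto_nhds_unique (hx (fun _ => 0) 0 tendsto_const_nhds) ?_
    simpa using hyp
  have hVx : ∀ σ, V (x σ) = ℓ := by
    intro σ
    have h1 := hVcont.continuousAt.tendsto.comp (hx (fun _ => σ) σ tendsto_const_nhds)
    refine tendsto_nhds_unique h1 ?_
    exact hℓ.comp ((tendsto_atTop_add_const_right _ σ tendsto_id).mono_left h𝒰)
  by_contra hpΛ
  have h3 := (hLyap x hxS 1 one_pos).2 (by rwa [hx0])
  rw [hVx, hVx] at h3
  exact lt_irrefl _ h3

end Aux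

/-- Benaïm–Hofbauer–Sorin. Let `F` satisfy Condition 1, `Λ` be compact,
`V` a Lyapunov function for `Λ` with `V(Λ)` of empty interior.  Then every bounded perturbed
solution `y` of `dx/dt ∈ F(x)` satisfies `⋂_{t ≥ 0} closure (y([t,∞))) ⊆ Λ`. -/
theorem stmt_18 {d : ℕ}
    (F : EuclideanSpace ℝ (Fin d) → Set (EuclideanSpace ℝ (Fin d)))
    -- Condition 1
    (hFgraph : IsClosed {p : EuclideanSpace ℝ (Fin d) × EuclideanSpace ℝ (Fin d) |
        p.2 ∈ F p.1})
    (hFne : ∀ θ, (F θ).Nonempty) (hFcpt : ∀ θ, IsCompact (F θ))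
    (hFconv : ∀ θ, Convex ℝ (F θ))
    (hFbdd : ∃ c > (0 : ℝ), ∀ θ, ∀ z ∈ F θ, ‖z‖ < c * (1 + ‖θ‖))
    -- Lyapunov function for the compact set Λ
    (Λ : Set (EuclideanSpace ℝ (Fin d))) (hΛ : IsCompact Λ)
    (V : EuclideanSpace ℝ (Fin d) → ℝ) (hVcont : Continuous V)
    (hLyap : ∀ x : ℝ → EuclideanSpace ℝ (Fin d), IsDISolution F x →
      ∀ t : ℝ, 0 < t → V (x t) ≤ V (x 0) ∧ (x 0 ∉ Λ → V (x t) < V (x 0)))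
    (hVint : interior (V '' Λ) = ∅)
    -- a bounded perturbed solution
    (y : ℝ → EuclideanSpace ℝ (Fin d))
    (hy : IsPerturbedSolution F y)
    (hybdd : ∃ M : ℝ, ∀ t : ℝ, 0 ≤ t → ‖y t‖ ≤ M) :
    (⋂ (t : ℝ) (_ : 0 ≤ t), closure (y '' Set.Ici t)) ⊆ Λ := by
  obtain ⟨c, hc, hFb⟩ := hFbdd
  obtain ⟨M, hM⟩ := hybdd
  obtain ⟨y', U, δ, hy'i, hy', hUi, hU, -, hδ, hF⟩ := hy
  have hy'I : ∀ a b : ℝ, IntervalIntegrable y' volume a b := fun a b =>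
    (hy'i 0 a le_rfl).symm.trans (hy'i 0 b le_rfl)
  have hUI : ∀ a b : ℝ, IntervalIntegrable U volume a b := fun a b =>
    (hUi 0 a le_rfl).symm.trans (hUi 0 b le_rfl)
  have hyc : ContinuousOn y (Set.Ici 0) := by
    have h1 : Continuous fun b => y 0 + ∫ t in (0 : ℝ)..b, y' t :=
      continuous_const.add (intervalIntegral.continuous_primitive hy'I 0)
    refine h1.continuousOn.congr fun b hb => ?_
    have := hy' 0 b le_rfl hb
    beta_reduce
    rw [← this]
    abel
  have hgF : ∀ᵐ r : ℝ, 0 < r → y' r - U r ∈ Fdelta F (δ r) (y r) :=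
    (ae_restrict_iff' measurableSet_Ioi).1 hF
  have hgI : ∀ a b : ℝ, IntervalIntegrable (fun r => y' r - U r) volume a b := fun a b =>
    (hy'I a b).sub (hUI a b)
  refine main_aux (IsDISolution F) Λ V hVcont hLyap hVint y hyc M hM ?_
  intro ι 𝒰 u hu
  refine limit_solution F hFgraph hFne hFcpt hFconv c hc hFb y (fun r => y' r - U r) δ M hM hgI hδ
    hgF ?_ 𝒰 u hu
  intro R hR ε hε
  have h1 := hU (2 * R) (by positivity) (ε / 2) (by positivity)
  have h2 : Tendsto (fun t : ℝ => t - R) atTop atTop :=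
    tendsto_atTop_add_const_right _ (-R) tendsto_id
  filter_upwards [h2.eventually h1, eventually_ge_atTop R] with t ht htR a ha b hb
  have e1 : ∀ q : ℝ, 0 ≤ q → y q - y 0 = ∫ s in (0 : ℝ)..q, y' s := fun q hq =>
    hy' 0 q le_rfl hq
  have e2 : y (t + b) - y (t + a) = ∫ s in (t + a)..(t + b), y' s := by
    rw [← intervalIntegral.integral_interval_sub_left (hy'I 0 (t + b)) (hy'I 0 (t + a)),
      ← e1 _ (by linarith [hb.1]), ← e1 _ (by linarith [ha.1])]
    abel
  have e3 : y (t + b) - y (t + a) - ∫ s in (t + a)..(t + b), (y' s - U s)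
      = ∫ s in (t + a)..(t + b), U s := by
    rw [e2, intervalIntegral.integral_sub (hy'I _ _) (hUI _ _)]
    abel
  rw [e3, ← intervalIntegral.integral_interval_sub_left (hUI (t - R) (t + b))
    (hUI (t - R) (t + a))]
  have e4 := ht (R + b) ⟨by linarith [hb.1], by linarith [hb.2]⟩
  have e5 := ht (R + a) ⟨by linarith [ha.1], by linarith [ha.2]⟩
  rw [show t - R + (R + b) = t + b by ring] at e4
  rw [show t - R + (R + a) = t + a by ring] at e5
  exact (norm_sub_le _ _).trans (by linarith)
end
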